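/- arXiv:math/0007008 — 2 statements merged into one kernel-verified Lean document; each statement's English description precedes it below -/
import Mathlib

section
/- Let E = ⋃_m I_m, where I_m = [a_m, b_m] (a_m < b_m) are pairwise disjoint closed intervals in ℝ with dist(0, I_m) → ∞ as m → ∞, and suppose there are constants c > 0 and M < ∞ such that |I_m| ≥ c(1 + dist(0, I_m))^{-M} for every m. Let u : ℂ → ℝ be continuous on ℂ, equal to 0 on E, positive and harmonic on ℂ∖E, symmetric (u(conj z) = u(z) for all z), and satisfy u(z) ≤ A(1+|z|) for some constant A. Then (log y)/u(iy) → 0 as y → +∞. -/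
open Complex Filter Set

/-- `h` is harmonic on `U`: real-valued, `C²` on `U`, with vanishing Laplacian. -/
def HarmonicOn (h : ℂ → ℝ) (U : Set ℂ) : Prop :=
  ContDiffOn ℝ 2 h U ∧ ∀ z ∈ U,
    iteratedFDerivWithin ℝ 2 h U z ![1, 1] +
      iteratedFDerivWithin ℝ 2 h U z ![Complex.I, Complex.I] = 0

/-- The subset of `ℂ` corresponding to a subset of `ℝ`. -/
def cplx (E : Set ℝ) : Set ℂ := (fun x : ℝ => (x : ℂ)) '' E

theorem harm_trans {u : ℂ → ℝ} {z a : ℂ} (h : InnerProductSpace.HarmonicAt u (z + a)) :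
    InnerProductSpace.HarmonicAt (fun w => u (w + a)) z := by
  obtain ⟨r, hr, hb⟩ := Metric.eventually_nhds_iff_ball.1 h.eventually
  obtain ⟨f, hf, hfu⟩ :=
    InnerProductSpace.HarmonicOnNhd.exists_analyticOnNhd_ball_re_eq (f := u) (z := z + a) (R := r) hb
  have h1 : AnalyticAt ℂ (fun w => f (w + a)) z := by
    have := hf (z + a) (Metric.mem_ball_self hr)
    exact AnalyticAt.fun_comp (f := fun w => w + a) (g := f) this (by fun_prop)
  refine (InnerProductSpace.harmonicAt_congr_nhds ?_).1 h1.harmonicAt_re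
  filter_upwards [Metric.ball_mem_nhds z hr] with w hw
  apply hfu
  simpa using hw

theorem max_princ {w : ℂ → ℝ} {K : Set ℂ} (hK : IsCompact K) (hc : ContinuousOn w K)
    (h : ∀ z ∈ K, w z ≤ 0 ∨ (z ∈ interior K ∧ InnerProductSpace.HarmonicAt w z)) :
    ∀ z ∈ K, w z ≤ 0 := by
  by_contra! hcon
  obtain ⟨z1, hz1, hpos⟩ := hcon
  obtain ⟨z2, hz2, hmax⟩ := hK.exists_isMaxOn ⟨z1, hz1⟩ hc
  have hm : 0 < w z2 := hpos.trans_le (hmax hz1)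
  have hS : IsCompact {z | z ∈ K ∧ w z = w z2} := by
    have : {z | z ∈ K ∧ w z = w z2} = K ∩ w ⁻¹' {w z2} := by ext; simp
    rw [this]
    exact hK.of_isClosed_subset (hc.preimage_isClosed_of_isClosed hK.isClosed isClosed_singleton)
      inter_subset_left
  obtain ⟨z0, ⟨hz0K, hz0⟩, hz0max⟩ := hS.exists_isMaxOn ⟨z2, hz2, rfl⟩
    Complex.continuous_re.continuousOn
  obtain hle | ⟨hint, hharm⟩ := h z0 hz0K
  · linarith
  obtain ⟨r, hr, hb⟩ := Metric.eventually_nhds_iff_ball.1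
    (hharm.eventually.and (mem_interior_iff_mem_nhds.1 hint : ∀ᶠ z in nhds z0, z ∈ K))
  obtain ⟨f, hf, hfu⟩ :=
    InnerProductSpace.HarmonicOnNhd.exists_analyticOnNhd_ball_re_eq (f := w) (z := z0) (R := r)
      (fun x hx => (hb x hx).1)
  have hball : ∀ᶠ z in nhds z0, z ∈ Metric.ball z0 r := Metric.ball_mem_nhds z0 hr
  have hd : ∀ᶠ z in nhds z0, DifferentiableAt ℂ (fun z => Complex.exp (f z)) z := by
    filter_upwards [hball] with z hz
    exact ((hf z hz).differentiableAt).cexp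
  have hloc : IsLocalMax (norm ∘ (fun z => Complex.exp (f z))) z0 := by
    filter_upwards [hball] with z hz
    simp only [Function.comp, Complex.norm_exp, Real.exp_le_exp]
    have h1 := hfu hz
    have h2 := hfu (Metric.mem_ball_self hr)
    simp only at h1 h2
    rw [h1, h2, hz0]
    exact hmax (hb z hz).2
  have hconst := Complex.eventually_eq_of_isLocalMax_norm hd hloc
  obtain ⟨r', hr', hb'⟩ := Metric.eventually_nhds_iff_ball.1 (hconst.and hball)
  have hmem : z0 + ((r' / 2 : ℝ) : ℂ) ∈ Metric.ball z0 r' := by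
    rw [Metric.mem_ball, dist_eq_norm, add_sub_cancel_left, Complex.norm_real, Real.norm_eq_abs,
      abs_of_pos (by positivity)]
    linarith
  obtain ⟨h3, h4⟩ := hb' _ hmem
  have h5 : w (z0 + ((r' / 2 : ℝ) : ℂ)) = w z0 := by
    have h1 := hfu h4
    have h2 := hfu (Metric.mem_ball_self hr)
    simp only at h1 h2
    rw [← h1, ← h2]
    have := congrArg norm h3
    simpa [Complex.norm_exp] using this
  have h6 := hz0max (show z0 + ((r' / 2 : ℝ) : ℂ) ∈ {z | z ∈ K ∧ w z = w z2} from
    ⟨(hb _ h4).2, by rw [h5, hz0]⟩)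
  simp only [Set.mem_ofPred_eq, Complex.add_re, Complex.ofReal_re] at h6
  linarith

theorem harnack {u : ℂ → ℝ} {c w : ℂ} {R : ℝ}
    (hf : InnerProductSpace.HarmonicOnNhd u (Metric.closedBall c R))
    (hpos : ∀ z ∈ Metric.closedBall c R, 0 ≤ u z) (hw : w ∈ Metric.ball c R) :
    u w ≤ (R + ‖w - c‖) / (R - ‖w - c‖) * u c ∧ (R - ‖w - c‖) / (R + ‖w - c‖) * u c ≤ u w := by
  have hR : 0 < R := Metric.pos_of_mem_ball hw
  have habs : |R| = R := abs_of_pos hR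
  have hmv : Real.circleAverage u c R = u c :=
    InnerProductSpace.HarmonicOnNhd.circleAverage_eq (by rwa [habs])
  have hP := hf.circleAverage_re_herglotzRieszKernel_smul hw
  have hcu : ContinuousOn u (Metric.sphere c |R|) := by
    rw [habs]
    exact hf.contDiffOn.continuousOn.mono Metric.sphere_subset_closedBall
  have hi : CircleIntegrable u c R := hcu.circleIntegrable'
  have hi2 : CircleIntegrable ((Complex.re ∘ herglotzRieszKernel c w) • u) c R := by
    apply ContinuousOn.circleIntegrable'
    exact (Complex.continuous_re.comp_continuousOn
      (continuousOn_herglotzRieszKernel_sphere hw)).smul hcu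
  have hcs : ∀ k : ℝ, Real.circleAverage (k • u) c R = k * u c := by
    intro k
    rw [Real.circleAverage_smul, hmv, smul_eq_mul]
  constructor
  · rw [← hcs, ← hP]
    apply Real.circleAverage_mono hi2 (hi.const_smul)
    intro z hz
    rw [habs] at hz
    simp only [Pi.smul_apply', Pi.smul_apply, smul_eq_mul, Function.comp]
    exact mul_le_mul_of_nonneg_right (re_herglotzRieszKernel_le hz hw)
      (hpos z (Metric.sphere_subset_closedBall hz))
  · rw [← hcs, ← hP]
    apply Real.circleAverage_mono (hi.const_smul) hi2
    intro z hz
    rw [habs] at hz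
    simp only [Pi.smul_apply', Pi.smul_apply, smul_eq_mul, Function.comp]
    exact mul_le_mul_of_nonneg_right (le_re_herglotzRieszKernel hz hw)
      (hpos z (Metric.sphere_subset_closedBall hz))
theorem harm_bridge {u : ℂ → ℝ} {U : Set ℂ} (hU : IsOpen U) (h : HarmonicOn u U) {z : ℂ}
    (hz : z ∈ U) : InnerProductSpace.HarmonicAt u z := by
  refine ⟨h.1.contDiffAt (hU.mem_nhds hz), ?_⟩
  filter_upwards [hU.mem_nhds hz] with w hw
  rw [InnerProductSpace.laplacian_eq_iteratedFDeriv_complexPlane]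
  have := h.2 w hw
  rw [iteratedFDerivWithin_of_isOpen 2 hU hw] at this
  simpa using this

theorem schwarz_pick_pos {N : ℂ → ℂ} (hN : ∀ z : ℂ, 0 < z.im → DifferentiableAt ℂ N z)
    (hpos : ∀ z : ℂ, 0 < z.im → 0 < (N z).im) {z w : ℂ} (hz : 0 < z.im) (hw : 0 < w.im) :
    ‖N z - N w‖ ^ 2 * (z.im * w.im) ≤ (N z).im * (N w).im * ‖z - w‖ ^ 2 := by
  have key : ∀ a b : ℂ, ‖a - (starRingEnd ℂ) b‖ ^ 2 = ‖a - b‖ ^ 2 + 4 * (a.im * b.im) := by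
    intro a b
    simp only [Complex.sq_norm, Complex.normSq_apply, Complex.sub_re, Complex.sub_im,
      Complex.conj_re, Complex.conj_im]
    ring
  have hne : ∀ a b : ℂ, 0 < a.im → 0 < b.im → a - (starRingEnd ℂ) b ≠ 0 := by
    intro a b ha hb h
    have := congrArg Complex.im h
    simp at this
    linarith
  set φ : ℂ → ℂ := fun ζ => (w - (starRingEnd ℂ) w * ζ) / (1 - ζ) with hφ
  have h1ne : ∀ ζ ∈ Metric.ball (0 : ℂ) 1, 1 - ζ ≠ 0 := by
    intro ζ hζ h
    have : ζ = 1 := by linear_combination -h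
    rw [this] at hζ
    simp at hζ
  have hφim : ∀ ζ ∈ Metric.ball (0 : ℂ) 1, 0 < (φ ζ).im := by
    intro ζ hζ
    have h0 : 0 < Complex.normSq (1 - ζ) := Complex.normSq_pos.2 (h1ne ζ hζ)
    have h1 : Complex.normSq ζ < 1 := by
      rw [Complex.normSq_eq_norm_sq]
      have : ‖ζ‖ < 1 := by simpa using hζ
      nlinarith [norm_nonneg ζ]
    have : (φ ζ).im = w.im * (1 - Complex.normSq ζ) / Complex.normSq (1 - ζ) := by
      rw [hφ]
      simp only [Complex.div_im]
      rw [← sub_div]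
      congr 1
      simp [Complex.normSq_apply]
      ring
    rw [this]
    have : 0 < 1 - Complex.normSq ζ := by linarith
    positivity
  set g : ℂ → ℂ := fun ζ => (N (φ ζ) - N w) / (N (φ ζ) - (starRingEnd ℂ) (N w)) with hg
  have hgd : DifferentiableOn ℂ g (Metric.ball 0 1) := by
    intro ζ hζ
    have hφd : DifferentiableAt ℂ φ ζ := by
      apply DifferentiableAt.div (by fun_prop) (by fun_prop) (h1ne ζ hζ)
    have hNφ : DifferentiableAt ℂ (fun ζ => N (φ ζ)) ζ :=
      DifferentiableAt.comp ζ (hN _ (hφim ζ hζ)) hφd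
    apply DifferentiableAt.differentiableWithinAt
    apply DifferentiableAt.div (hNφ.sub_const _) (hNφ.sub_const _)
    exact hne _ _ (hpos _ (hφim ζ hζ)) (hpos _ hw)
  have hg0 : g 0 = 0 := by simp [hg, hφ]
  have hgm : MapsTo g (Metric.ball 0 1) (Metric.closedBall 0 1) := by
    intro ζ hζ
    rw [mem_closedBall_zero_iff]
    simp only [hg, norm_div]
    apply div_le_one_of_le₀ _ (norm_nonneg _)
    have h2 := key (N (φ ζ)) (N w)
    have h3 := hpos _ (hφim ζ hζ)
    have h4 := hpos _ hw
    apply le_of_sq_le_sq _ (norm_nonneg _)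
    rw [h2]
    nlinarith [mul_pos h3 h4]
  have hzw : z - (starRingEnd ℂ) w ≠ 0 := hne _ _ hz hw
  set ζ := (z - w) / (z - (starRingEnd ℂ) w) with hζ
  have hζn : ‖ζ‖ < 1 := by
    rw [hζ, norm_div, div_lt_one (norm_pos_iff.2 hzw)]
    have h2 := key z w
    apply lt_of_pow_lt_pow_left₀ 2 (norm_nonneg _)
    rw [h2]
    nlinarith [mul_pos hz hw]
  have hφζ : φ ζ = z := by
    have hwne : w - (starRingEnd ℂ) w ≠ 0 := hne _ _ hw hw
    have h1 : 1 - ζ ≠ 0 := h1ne ζ (by simpa using hζn)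
    simp only [hφ]
    rw [div_eq_iff h1, hζ]
    field_simp
    ring
  have hfin := Complex.norm_le_norm_of_mapsTo_ball hgd hgm hg0 hζn
  simp only [hg] at hfin
  rw [hφζ, hζ, norm_div, norm_div, div_le_div_iff₀ (norm_pos_iff.2 (hne _ _ (hpos _ hz) (hpos _ hw)))
    (norm_pos_iff.2 hzw)] at hfin
  have h5 := pow_le_pow_left₀ (by positivity) hfin 2
  rw [mul_pow, mul_pow, key, key] at h5
  nlinarith

theorem schwarz_pick {N : ℂ → ℂ} (hN : ∀ z : ℂ, 0 < z.im → DifferentiableAt ℂ N z)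
    (hpos : ∀ z : ℂ, 0 < z.im → 0 ≤ (N z).im) {z w : ℂ} (hz : 0 < z.im) (hw : 0 < w.im) :
    ‖N z - N w‖ ^ 2 * (z.im * w.im) ≤ (N z).im * (N w).im * ‖z - w‖ ^ 2 := by
  have h : ∀ ε : ℝ, 0 < ε → ‖N z - N w‖ ^ 2 * (z.im * w.im) ≤
      ((N z).im + ε) * ((N w).im + ε) * ‖z - w‖ ^ 2 := by
    intro ε hε
    have := schwarz_pick_pos (N := fun z => N z + (ε : ℂ) * I)
      (fun z hz => (hN z hz).add_const _) (fun z hz => by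
        have := hpos z hz
        simp
        linarith) hz hw
    simpa using this
  have ht : Tendsto (fun ε : ℝ => ((N z).im + ε) * ((N w).im + ε) * ‖z - w‖ ^ 2)
      (nhdsWithin 0 (Ioi 0)) (nhds (((N z).im + 0) * ((N w).im + 0) * ‖z - w‖ ^ 2)) := by
    apply Tendsto.mono_left _ nhdsWithin_le_nhds
    exact Continuous.tendsto (by fun_prop) 0
  have := ge_of_tendsto ht (by filter_upwards [self_mem_nhdsWithin] with ε hε using h ε hε)
  simpa using this

/-- barrier estimate on a half disc with zero boundary values on the diameter -/
theorem half_disc {u : ℂ → ℝ} (hu : Continuous u)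
    (hharm : ∀ z : ℂ, z.im ≠ 0 → InnerProductSpace.HarmonicAt u z) {p ρ S : ℝ} (hρ : 0 < ρ)
    (hS : 0 ≤ S) (hzero : ∀ x : ℝ, |x - p| ≤ ρ → u (x : ℂ) = 0)
    (hbd : ∀ z : ℂ, ‖z - p‖ ≤ ρ → u z ≤ S) {y : ℝ} (hy0 : 0 ≤ y) (hy : y ≤ ρ) :
    u ⟨p, y⟩ ≤ 2 * S * (y / ρ) := by
  set q : ℂ → ℂ := fun z => ((S / ρ ^ 2 : ℝ) : ℂ) * (z - p) ^ 2 - ((2 * S / ρ : ℝ) : ℂ) * I * z with hq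
  have hqre : ∀ z, (q z).re = S / ρ ^ 2 * ((z.re - p) ^ 2 - z.im ^ 2) + 2 * S / ρ * z.im := by
    intro z
    simp only [hq]
    rw [Complex.sub_re, Complex.re_ofReal_mul, mul_assoc, Complex.re_ofReal_mul]
    simp [pow_two]
  have hqan : ∀ z, AnalyticAt ℂ q z := by intro z; simp only [hq]; fun_prop
  set K : Set ℂ := Metric.closedBall (p : ℂ) ρ ∩ {z | 0 ≤ z.im} with hK
  have hKc : IsCompact K := (isCompact_closedBall _ _).inter_right
    (isClosed_le continuous_const Complex.continuous_im)
  have hn : ∀ z : ℂ, ‖z - p‖ ^ 2 = (z.re - p) ^ 2 + z.im ^ 2 := by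
    intro z
    simp [Complex.sq_norm, Complex.normSq_apply]; ring
  have hsp : S / ρ ^ 2 * ρ ^ 2 = S := by field_simp
  have main := max_princ (w := u - fun z => (q z).re) hKc
    (by
      apply Continuous.continuousOn
      apply hu.sub
      apply Complex.continuous_re.comp
      simp only [hq]; fun_prop)
    (by
      rintro z ⟨hz1, hz2⟩
      rw [mem_closedBall_iff_norm] at hz1
      change 0 ≤ z.im at hz2
      have hSr : 0 ≤ S / ρ ^ 2 := by positivity
      rcases hz2.eq_or_lt with h0 | h0
      · left
        have hz : z = (z.re : ℂ) := by apply Complex.ext <;> simp [h0]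
        have : u z = 0 := by
          rw [hz]; apply hzero
          have h := hn z
          rw [← h0] at h
          apply abs_le_of_sq_le_sq _ hρ.le
          nlinarith [norm_nonneg (z - p)]
        simp only [Pi.sub_apply, this, hqre, ← h0]
        have := mul_nonneg hSr (sq_nonneg (z.re - p))
        linarith
      rcases hz1.eq_or_lt with h1 | h1
      · left
        have h2 := hn z
        rw [h1] at h2
        have h3 : z.im ≤ ρ := by
          apply le_of_sq_le_sq _ hρ.le
          nlinarith [sq_nonneg (z.re - p)]
        simp only [Pi.sub_apply, hqre]
        have h4 := hbd z h1.le
        have h5 : 2 * S / ρ * z.im = S / ρ ^ 2 * (2 * ρ * z.im) := by field_simp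
        rw [h5]
        have h6 : S ≤ S / ρ ^ 2 * ((z.re - p) ^ 2 - z.im ^ 2 + 2 * ρ * z.im) := by
          nth_rw 1 [← hsp]
          apply mul_le_mul_of_nonneg_left _ hSr
          nlinarith
        linarith
      · right
        constructor
        · apply mem_interior.2
          refine ⟨Metric.ball (p : ℂ) ρ ∩ {z | 0 < z.im}, ?_, ?_, ?_⟩
          · exact inter_subset_inter Metric.ball_subset_closedBall (fun z hz => show (0 : ℝ) ≤ z.im from le_of_lt hz)
          · exact Metric.isOpen_ball.inter (isOpen_lt continuous_const Complex.continuous_im)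
          · exact ⟨mem_ball_iff_norm.2 h1, h0⟩
        · exact (hharm z h0.ne').sub (hqan z).harmonicAt_re)
  have hmem : (⟨p, y⟩ : ℂ) ∈ K := by
    refine ⟨?_, hy0⟩
    rw [mem_closedBall_iff_norm]
    apply le_of_sq_le_sq _ hρ.le
    rw [hn]
    simp
    nlinarith
  have := main _ hmem
  simp only [Pi.sub_apply, hqre] at this
  have h7 : 0 ≤ S / ρ ^ 2 * y ^ 2 := by positivity
  have h8 : 2 * S * (y / ρ) = 2 * S / ρ * y := by ring
  rw [h8]
  simp at this
  linarith
theorem hp_harnack {u : ℂ → ℝ}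
    (hharm : ∀ z : ℂ, z.im ≠ 0 → InnerProductSpace.HarmonicAt u z)
    (hpos : ∀ z : ℂ, 0 ≤ u z) {x y R : ℝ} (hy : 0 < y) (hyR : y ≤ R) (hx : |x| ≤ R) :
    u ⟨x, y⟩ ≤ 100 * (R / y) * u ⟨0, R⟩ := by
  have hR : 0 < R := hy.trans_le hyR
  have hball : ∀ (c : ℂ) (r : ℝ), r < c.im →
      InnerProductSpace.HarmonicOnNhd u (Metric.closedBall c r) := by
    intro c r hr z hz
    apply hharm
    rw [mem_closedBall_iff_norm] at hz
    have h1 := (Complex.abs_im_le_norm (z - c)).trans hz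
    rw [Complex.sub_im] at h1
    have := (abs_le.1 h1).1
    have : 0 < z.im := by linarith
    exact this.ne'
  have hnr : ∀ a b c : ℝ, ‖(⟨a, c⟩ : ℂ) - ⟨b, c⟩‖ = |a - b| := by
    intro a b c
    rw [show (⟨a, c⟩ : ℂ) - ⟨b, c⟩ = ((a - b : ℝ) : ℂ) by apply Complex.ext <;> simp,
      Complex.norm_real, Real.norm_eq_abs]
  have hni : ∀ a b c : ℝ, ‖(⟨a, b⟩ : ℂ) - ⟨a, c⟩‖ = |b - c| := by
    intro a b c
    rw [show (⟨a, b⟩ : ℂ) - ⟨a, c⟩ = ((b - c : ℝ) : ℂ) * I by apply Complex.ext <;> simp,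
      norm_mul, Complex.norm_real, Real.norm_eq_abs, Complex.norm_I, mul_one]
  -- horizontal steps
  have hstep : ∀ a b : ℝ, |a - b| ≤ R / 2 → u ⟨a, R⟩ ≤ 5 * u ⟨b, R⟩ := by
    intro a b hab
    have h := (harnack (u := u) (c := ⟨b, R⟩) (w := ⟨a, R⟩) (R := 3 / 4 * R)
      (hball _ _ (by simp; linarith)) (fun z _ => hpos z)
      (by rw [mem_ball_iff_norm, hnr]; linarith)).1
    rw [hnr] at h
    refine h.trans (mul_le_mul_of_nonneg_right ?_ (hpos _))
    rw [div_le_iff₀ (by linarith)]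
    linarith
  have h1 : u ⟨x, R⟩ ≤ 25 * u ⟨0, R⟩ := by
    have e1 := hstep x (x / 2) (by
      rw [show x - x / 2 = x / 2 by ring, abs_div, abs_two]; linarith)
    have e2 := hstep (x / 2) 0 (by
      rw [sub_zero, abs_div, abs_two]; linarith)
    linarith
  have h2 : u ⟨x, y⟩ ≤ 4 * (R / y) * u ⟨x, R⟩ := by
    have e : |y - R| = R - y := by rw [abs_of_nonpos (by linarith)]; ring
    have h := (harnack (u := u) (c := ⟨x, R⟩) (w := ⟨x, y⟩) (R := R - y / 2)
      (hball _ _ (by simp; linarith)) (fun z _ => hpos z)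
      (by rw [mem_ball_iff_norm, hni, e]; linarith)).1
    rw [hni, e] at h
    refine h.trans (mul_le_mul_of_nonneg_right ?_ (hpos _))
    rw [div_le_iff₀ (by linarith)]
    have : 4 * (R / y) * (R - y / 2 - (R - y)) = 2 * R := by field_simp; ring
    rw [this]; linarith
  have h3 : 0 ≤ 4 * (R / y) := by positivity
  nlinarith [mul_le_mul_of_nonneg_left h1 h3]

/-- gradient estimate -/
theorem grad_est {u : ℂ → ℝ}
    (hharm : ∀ z : ℂ, z.im ≠ 0 → InnerProductSpace.HarmonicAt u z)
    (hpos : ∀ z : ℂ, 0 ≤ u z) {c : ℂ} (hc : 0 < c.im) :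
    ‖fderiv ℝ u c‖ ≤ 8 * u c / c.im := by
  apply norm_fderiv_le_of_lip' ℝ (by have := hpos c; positivity)
  filter_upwards [Metric.ball_mem_nhds c (show 0 < c.im / 4 by linarith)] with w hw
  rw [mem_ball_iff_norm] at hw
  obtain ⟨h1, h2⟩ := harnack (u := u) (c := c) (w := w) (R := c.im / 2)
    (by
      intro z hz
      apply hharm
      rw [mem_closedBall_iff_norm] at hz
      have h1 := (Complex.abs_im_le_norm (z - c)).trans hz
      rw [Complex.sub_im] at h1
      have := (abs_le.1 h1).1
      have : 0 < z.im := by linarith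
      exact this.ne') (fun z _ => hpos z) (by rw [mem_ball_iff_norm]; linarith)
  set r := ‖w - c‖
  have hr : 0 ≤ r := norm_nonneg _
  have hu := hpos c
  have e1 : (c.im / 2 + r) / (c.im / 2 - r) ≤ 1 + 8 * r / c.im := by
    rw [div_le_iff₀ (by linarith)]
    have : 8 * r / c.im * (c.im / 2 - r) = 4 * r - 8 * r * (r / c.im) := by field_simp; ring
    have h3 : r / c.im ≤ 1 / 4 := by rw [div_le_iff₀ hc]; linarith
    nlinarith
  have e2 : 1 - 8 * r / c.im ≤ (c.im / 2 - r) / (c.im / 2 + r) := by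
    rw [le_div_iff₀ (by linarith)]
    have : 8 * r / c.im * (c.im / 2 + r) = 4 * r + 8 * r * (r / c.im) := by field_simp; ring
    have h3 : 0 ≤ r * (r / c.im) := by positivity
    nlinarith
  have e3 := mul_le_mul_of_nonneg_right e1 hu
  have e4 := mul_le_mul_of_nonneg_right e2 hu
  have e5 : 8 * u c / c.im * r = 8 * r / c.im * u c := by ring
  rw [Real.norm_eq_abs, abs_le, e5]
  constructor <;> linarith

theorem refl_step {u : ℂ → ℝ} (hu : Continuous u)
    (hh : ∀ z : ℂ, 0 < u z → InnerProductSpace.HarmonicAt u z)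
    (hharm : ∀ z : ℂ, z.im ≠ 0 → InnerProductSpace.HarmonicAt u z)
    (hpos : ∀ z : ℂ, 0 ≤ u z) (hsymm : ∀ z : ℂ, u (starRingEnd ℂ z) = u z)
    {A : ℝ} (hA : 0 ≤ A) (hgr : ∀ z : ℂ, u z ≤ A * (1 + ‖z‖)) {h R : ℝ} (hh0 : 0 < h) (hR : 1 ≤ R)
    (hRh : h ≤ R) {z0 : ℂ} (hz0 : 0 < z0.im) (hz0R : ‖z0‖ < R) :
    u (z0 - h * I) - u (z0 + h * I) ≤
      (6 * A * h + 200 * u ⟨0, R⟩) * (2 * R * z0 / (R ^ 2 - z0 ^ 2)).im := by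
  have hR0 : 0 < R := by linarith
  set t : ℝ := 6 * A * h + 200 * u ⟨0, R⟩ with ht
  have ht0 : 0 ≤ t := by have := hpos ⟨0, R⟩; positivity
  set q : ℂ → ℂ := fun z => 2 * R * z / (R ^ 2 - z ^ 2) with hq
  set D : ℂ → ℝ := fun z => u (z + (- (h * I))) - u (z + h * I) with hD
  have hDc : Continuous D := by simp only [hD]; fun_prop
  have hD0 : ∀ x : ℝ, D x = 0 := by
    intro x
    simp only [hD]
    rw [sub_eq_zero, ← hsymm]
    simp
  -- nonvanishing denominators away from the two corners
  have hden : ∀ z : ℂ, z ≠ R → z ≠ -R → (R : ℂ) ^ 2 - z ^ 2 ≠ 0 := by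
    intro z h1 h2 h3
    have : (z - R) * (z + R) = 0 := by linear_combination -h3
    rcases mul_eq_zero.1 this with h4 | h4
    · exact h1 (by linear_combination h4)
    · exact h2 (by linear_combination h4)
  have hqim : ∀ z : ℂ, (q z).im = 2 * R * z.im * (R ^ 2 + Complex.normSq z) /
      Complex.normSq (R ^ 2 - z ^ 2) := by
    intro z
    simp only [hq]
    rw [Complex.div_im, ← sub_div]
    congr 1
    simp [Complex.normSq_apply, pow_two]
    ring
  have hq0 : ∀ z : ℂ, 0 ≤ z.im → 0 ≤ (q z).im := by
    intro z hz
    rw [hqim]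
    have := Complex.normSq_nonneg z
    have := Complex.normSq_nonneg ((R : ℂ) ^ 2 - z ^ 2)
    positivity
  have hqarc : ∀ z : ℂ, 0 < z.im → ‖z‖ = R → (q z).im = R / z.im := by
    intro z hz hzR
    have hzn : z.re * z.re + z.im * z.im = R ^ 2 := by
      rw [← hzR, Complex.sq_norm, Complex.normSq_apply]
    have e : Complex.normSq ((R : ℂ) ^ 2 - z ^ 2) = 4 * R ^ 2 * z.im ^ 2 := by
      simp only [Complex.normSq_apply, pow_two, Complex.sub_re, Complex.sub_im, Complex.mul_re,
        Complex.mul_im, Complex.ofReal_re, Complex.ofReal_im]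
      have : R * R = z.re * z.re + z.im * z.im := by rw [hzn]; ring
      simp only [mul_zero, sub_zero, zero_mul, add_zero, zero_sub]
      rw [this]; ring
    rw [hqim, e, Complex.normSq_apply, hzn]
    field_simp
    ring
  -- estimate on the arc
  have harc : ∀ z : ℂ, 0 < z.im → ‖z‖ = R → D z ≤ t * (q z).im := by
    intro z hz hzR
    rw [hqarc z hz hzR]
    have hzim : z.im ≤ R := by rw [← hzR]; exact (le_abs_self _).trans (Complex.abs_im_le_norm z)
    have hzre : |z.re| ≤ R := by rw [← hzR]; exact Complex.abs_re_le_norm z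
    have h1 : D z ≤ u (z + (-(h * I))) := by simp only [hD]; linarith [hpos (z + h * I)]
    refine h1.trans ?_
    have hup := hpos ⟨0, R⟩
    have hRy : 0 ≤ R / z.im := by positivity
    rcases le_or_gt z.im (2 * h) with h2 | h2
    · have h3 := hgr (z + (-(h * I)))
      have h4 : ‖z + (-(h * I))‖ ≤ R + h := by
        refine (norm_add_le _ _).trans ?_
        rw [hzR, norm_neg, norm_mul, Complex.norm_real, Complex.norm_I, Real.norm_eq_abs,
          abs_of_pos hh0, mul_one]
      have h5 : A * (1 + ‖z + (-(h * I))‖) ≤ A * (3 * R) :=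
        mul_le_mul_of_nonneg_left (by linarith) hA
      have h6 : A * (3 * R) ≤ 6 * A * h * (R / z.im) := by
        have : A * (3 * R) = 3 * A * z.im * (R / z.im) := by field_simp
        rw [this]
        apply mul_le_mul_of_nonneg_right _ hRy
        nlinarith
      have h7 : 0 ≤ 200 * u ⟨0, R⟩ * (R / z.im) := by positivity
      rw [ht, add_mul]; linarith
    · have h3 := hp_harnack hharm hpos (x := z.re) (y := z.im - h) (R := R) (by linarith)
        (by linarith) hzre
      have e : z + (-(h * I)) = ⟨z.re, z.im - h⟩ := by
        apply Complex.ext <;> simp; ring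
      rw [e]
      have h4 : R / (z.im - h) ≤ 2 * (R / z.im) := by
        rw [div_le_iff₀ (by linarith)]
        have : 2 * (R / z.im) * (z.im - h) = 2 * R - 2 * R * (h / z.im) := by field_simp
        have h5 : h / z.im ≤ 1 / 2 := by rw [div_le_iff₀ hz]; linarith
        nlinarith
      have h5 : 0 ≤ 6 * A * h * (R / z.im) := by positivity
      have h6 : 100 * (R / (z.im - h)) * u ⟨0, R⟩ ≤ 100 * (2 * (R / z.im)) * u ⟨0, R⟩ :=
        mul_le_mul_of_nonneg_right (by linarith) hup
      rw [ht, add_mul]; linarith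
  -- the maximum principle
  suffices hs : ∀ ε > 0, D z0 - t * (q z0).im - ε ≤ 0 by
    have : D z0 ≤ t * (q z0).im := by
      apply le_of_forall_pos_le_add
      intro ε hε
      linarith [hs ε hε]
    rw [sub_eq_add_neg z0]
    exact this
  intro ε hε
  have hnear : ∀ x : ℝ, ∃ r > 0, ∀ z ∈ Metric.ball (x : ℂ) r, D z < ε := by
    intro x
    have : ∀ᶠ z in nhds (x : ℂ), D z < ε :=
      hDc.continuousAt.eventually_lt continuousAt_const (by rw [hD0]; exact hε)
    exact Metric.eventually_nhds_iff_ball.1 this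
  obtain ⟨r1, hr1, hb1⟩ := hnear R
  obtain ⟨r2, hr2, hb2⟩ := hnear (-R)
  set r : ℝ := min (min (r1 / 2) (r2 / 2)) (z0.im) with hrdef
  have hr : 0 < r := by simp only [hrdef]; positivity
  have hrr1 : r < r1 := by
    have : r ≤ r1 / 2 := (min_le_left _ _).trans (min_le_left _ _)
    linarith
  have hrr2 : r < r2 := by
    have : r ≤ r2 / 2 := (min_le_left _ _).trans (min_le_right _ _)
    linarith
  have hrz : r ≤ z0.im := min_le_right _ _
  set K : Set ℂ := (Metric.closedBall (0 : ℂ) R ∩ {z | 0 ≤ z.im}) ∩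
    ((Metric.ball (R : ℂ) r)ᶜ ∩ (Metric.ball (-R : ℂ) r)ᶜ) with hK
  have hKc : IsCompact K := ((isCompact_closedBall _ _).inter_right
    (isClosed_le continuous_const Complex.continuous_im)).inter_right
    (Metric.isOpen_ball.isClosed_compl.inter Metric.isOpen_ball.isClosed_compl)
  have hKne : ∀ z ∈ K, z ≠ R ∧ z ≠ -R := by
    rintro z ⟨-, h1, h2⟩
    constructor
    · rintro rfl; exact h1 (Metric.mem_ball_self hr)
    · rintro rfl; exact h2 (Metric.mem_ball_self hr)
  have hqan : ∀ z : ℂ, z ≠ R → z ≠ -R → AnalyticAt ℂ q z := by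
    intro z h1 h2
    simp only [hq]
    exact AnalyticAt.fun_div (by fun_prop) (by fun_prop) (hden z h1 h2)
  have hmem : z0 ∈ K := by
    refine ⟨⟨?_, hz0.le⟩, ?_, ?_⟩
    · simpa using hz0R.le
    · intro hz
      rw [mem_ball_iff_norm] at hz
      have := (Complex.abs_im_le_norm _).trans_lt hz
      simp at this
      rw [abs_of_pos hz0] at this
      linarith
    · intro hz
      rw [mem_ball_iff_norm] at hz
      have := (Complex.abs_im_le_norm _).trans_lt hz
      simp at this
      rw [abs_of_pos hz0] at this
      linarith
  refine max_princ (w := fun z => D z - t * (q z).im - ε) hKc ?_ ?_ z0 hmem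
  · intro z hz
    have := (hqan z (hKne z hz).1 (hKne z hz).2).continuousAt
    apply ContinuousAt.continuousWithinAt
    exact (hDc.continuousAt.sub (continuousAt_const.mul
      (Complex.continuous_im.continuousAt.comp this))).sub continuousAt_const
  · intro z hz
    obtain ⟨⟨hz1, hz2⟩, hz3, hz4⟩ := hz
    have hne := hKne z ⟨⟨hz1, hz2⟩, hz3, hz4⟩
    change 0 ≤ z.im at hz2
    have hqz := mul_nonneg ht0 (hq0 z hz2)
    by_cases hD1 : D z ≤ ε
    · left
      show D z - t * (q z).im - ε ≤ 0
      linarith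
    by_cases h3 : z ∈ Metric.closedBall (R : ℂ) r
    · exact absurd (hb1 z (Metric.closedBall_subset_ball hrr1 h3)).le hD1
    by_cases h4 : z ∈ Metric.closedBall (-R : ℂ) r
    · exact absurd (hb2 z (by
        push_cast
        exact Metric.closedBall_subset_ball hrr2 h4)).le hD1
    rcases hz2.eq_or_lt with h0 | h0
    · have hz : z = (z.re : ℂ) := by apply Complex.ext <;> simp [h0]
      rw [hz, hD0] at hD1
      exact absurd hε.le hD1
    rw [mem_closedBall_zero_iff] at hz1
    rcases hz1.eq_or_lt with h1 | h1
    · left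
      have := harc z h0 h1
      show D z - t * (q z).im - ε ≤ 0
      linarith
    · right
      constructor
      · apply mem_interior.2
        refine ⟨(Metric.ball (0 : ℂ) R ∩ {z | 0 < z.im}) ∩
          ((Metric.closedBall (R : ℂ) r)ᶜ ∩ (Metric.closedBall (-R : ℂ) r)ᶜ), ?_, ?_, ?_⟩
        · refine inter_subset_inter (inter_subset_inter Metric.ball_subset_closedBall
            (fun z hz => show (0 : ℝ) ≤ z.im from le_of_lt hz)) (inter_subset_inter ?_ ?_)
          · exact compl_subset_compl.2 Metric.ball_subset_closedBall
          · exact compl_subset_compl.2 Metric.ball_subset_closedBall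
        · exact (Metric.isOpen_ball.inter (isOpen_lt continuous_const Complex.continuous_im)).inter
            (Metric.isClosed_closedBall.isOpen_compl.inter Metric.isClosed_closedBall.isOpen_compl)
        · exact ⟨⟨by simpa using h1, h0⟩, h3, h4⟩
      · have hu1 : InnerProductSpace.HarmonicAt u (z + (-(h * I))) := by
          apply hh
          have : ε < D z := not_le.1 hD1
          simp only [hD] at this
          linarith [hpos (z + h * I)]
        have hu2 : InnerProductSpace.HarmonicAt u (z + h * I) := by
          apply hharm
          simp
          linarith
        have hc : InnerProductSpace.HarmonicAt (fun _ : ℂ => ε) z :=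
          (InnerProductSpace.harmonicContOnCl_const (s := univ)).1 z (mem_univ z)
        have hqh : InnerProductSpace.HarmonicAt (t • fun z => (q z).im) z :=
          (hqan z hne.1 hne.2).harmonicAt_im.const_smul
        exact (((harm_trans hu1).sub (harm_trans hu2)).sub hqh).sub hc
theorem log_div_tendsto : Tendsto (fun R : ℝ => Real.log R / R) atTop (nhds 0) :=
  Real.isLittleO_log_id_atTop.tendsto_div_nhds_zero

theorem mono_u {u : ℂ → ℝ} (hu : Continuous u)
    (hh : ∀ z : ℂ, 0 < u z → InnerProductSpace.HarmonicAt u z)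
    (hharm : ∀ z : ℂ, z.im ≠ 0 → InnerProductSpace.HarmonicAt u z)
    (hpos : ∀ z : ℂ, 0 ≤ u z) (hsymm : ∀ z : ℂ, u (starRingEnd ℂ z) = u z)
    {A : ℝ} (hA : 0 ≤ A) (hgr : ∀ z : ℂ, u z ≤ A * (1 + ‖z‖)) {K0 : ℝ} (hK0 : 0 ≤ K0)
    (hfr : ∃ᶠ R : ℝ in atTop, u ⟨0, R⟩ ≤ K0 * Real.log R)
    (x y1 y2 : ℝ) (hy1 : 0 < y1) (hy : y1 ≤ y2) : u ⟨x, y1⟩ ≤ u ⟨x, y2⟩ := by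
  rcases hy.eq_or_lt with rfl | hlt
  · exact le_rfl
  set z0 : ℂ := ⟨x, (y1 + y2) / 2⟩ with hz0
  set h : ℝ := (y2 - y1) / 2 with hhd
  have hh0 : 0 < h := by simp only [hhd]; linarith
  have hz0im : 0 < z0.im := by simp only [hz0]; linarith
  have e1 : z0 - h * I = ⟨x, y1⟩ := by
    apply Complex.ext <;> simp [hz0, hhd]; ring
  have e2 : z0 + h * I = ⟨x, y2⟩ := by
    apply Complex.ext <;> simp [hz0, hhd]; ring
  have ht : Tendsto (fun R : ℝ => (6 * A * h) * (4 * ‖z0‖) * R⁻¹ +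
      200 * K0 * (4 * ‖z0‖) * (Real.log R / R)) atTop (nhds 0) := by
    simpa using (tendsto_inv_atTop_zero.const_mul ((6 * A * h) * (4 * ‖z0‖))).add
      (log_div_tendsto.const_mul (200 * K0 * (4 * ‖z0‖)))
  apply le_of_forall_pos_le_add
  intro ε hε
  obtain ⟨R, hR1, ⟨⟨hR2, hR3⟩, hR4⟩, hR5⟩ := (hfr.and_eventually
    (((eventually_ge_atTop 1).and (eventually_ge_atTop h)).and
      (eventually_gt_atTop (2 * ‖z0‖)) |>.and (ht.eventually_lt_const hε))).exists
  have hR0 : 0 < R := by linarith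
  have hn := norm_nonneg z0
  have := refl_step hu hh hharm hpos hsymm hA hgr hh0 hR2 hR3 hz0im (by linarith)
  rw [e1, e2] at this
  have hq : (2 * R * z0 / (R ^ 2 - z0 ^ 2)).im ≤ 4 * ‖z0‖ / R := by
    refine (le_abs_self _).trans ((Complex.abs_im_le_norm _).trans ?_)
    have hd : R ^ 2 - ‖z0‖ ^ 2 ≤ ‖(R : ℂ) ^ 2 - z0 ^ 2‖ := by
      have := norm_sub_norm_le ((R : ℂ) ^ 2) (z0 ^ 2)
      rwa [norm_pow, norm_pow, Complex.norm_real, Real.norm_eq_abs, sq_abs] at this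
    have hd2 : R ^ 2 / 2 ≤ R ^ 2 - ‖z0‖ ^ 2 := by nlinarith
    have hd3 : 0 < R ^ 2 / 2 := by positivity
    rw [norm_div, norm_mul, norm_mul, Complex.norm_real, Real.norm_eq_abs, abs_of_pos hR0,
      Complex.norm_two]
    calc 2 * R * ‖z0‖ / ‖(R : ℂ) ^ 2 - z0 ^ 2‖ ≤ 2 * R * ‖z0‖ / (R ^ 2 / 2) := by
          apply div_le_div_of_nonneg_left (by positivity) hd3 (by linarith)
      _ = 4 * ‖z0‖ / R := by field_simp; norm_num; ring
  have hup := hpos ⟨0, R⟩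
  have h1 : (6 * A * h + 200 * u ⟨0, R⟩) * (2 * R * z0 / (R ^ 2 - z0 ^ 2)).im ≤
      (6 * A * h + 200 * (K0 * Real.log R)) * (4 * ‖z0‖ / R) := by
    refine (mul_le_mul_of_nonneg_left hq (by positivity)).trans ?_
    apply mul_le_mul_of_nonneg_right _ (by positivity)
    linarith
  have h2 : (6 * A * h + 200 * (K0 * Real.log R)) * (4 * ‖z0‖ / R) =
    (6 * A * h) * (4 * ‖z0‖) * R⁻¹ + 200 * K0 * (4 * ‖z0‖) * (Real.log R / R) := by
    field_simp
  linarith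

theorem deriv_vert {u : ℂ → ℝ} (hharm : ∀ z : ℂ, z.im ≠ 0 → InnerProductSpace.HarmonicAt u z)
    (x y : ℝ) (hy : 0 < y) :
    HasDerivAt (fun s : ℝ => u ⟨x, s⟩) (fderiv ℝ u ⟨x, y⟩ I) y := by
  have hd : HasFDerivAt u (fderiv ℝ u ⟨x, y⟩) ⟨x, y⟩ :=
    ((hharm ⟨x, y⟩ hy.ne').1.differentiableAt two_ne_zero).hasFDerivAt
  have hl : HasDerivAt (fun s : ℝ => (⟨x, s⟩ : ℂ)) I y := by
    have h1 : HasDerivAt (fun s : ℝ => (x : ℂ) + (s : ℂ) * I) (1 * I) y :=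
      ((Complex.ofRealCLM.hasDerivAt (x := y)).mul_const I).const_add _
    rw [one_mul] at h1
    convert h1 using 2 with s
    apply Complex.ext <;> simp
  exact hd.comp_hasDerivAt y hl

theorem deriv_horiz {u : ℂ → ℝ} (hharm : ∀ z : ℂ, z.im ≠ 0 → InnerProductSpace.HarmonicAt u z)
    (x y : ℝ) (hy : 0 < y) :
    HasDerivAt (fun s : ℝ => u ⟨s, y⟩) (fderiv ℝ u ⟨x, y⟩ 1) x := by
  have hd : HasFDerivAt u (fderiv ℝ u ⟨x, y⟩) ⟨x, y⟩ :=
    ((hharm ⟨x, y⟩ hy.ne').1.differentiableAt two_ne_zero).hasFDerivAt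
  have hl : HasDerivAt (fun s : ℝ => (⟨s, y⟩ : ℂ)) 1 x := by
    have h1 : HasDerivAt (fun s : ℝ => (s : ℂ) + (y : ℂ) * I) 1 x :=
      (Complex.ofRealCLM.hasDerivAt (x := x)).add_const _
    convert h1 using 2 with s
    apply Complex.ext <;> simp
  exact hd.comp_hasDerivAt x hl

theorem V_nonneg {u : ℂ → ℝ} (hharm : ∀ z : ℂ, z.im ≠ 0 → InnerProductSpace.HarmonicAt u z)
    (hmono : ∀ x y1 y2 : ℝ, 0 < y1 → y1 ≤ y2 → u ⟨x, y1⟩ ≤ u ⟨x, y2⟩) (z : ℂ) (hz : 0 < z.im) :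
    0 ≤ fderiv ℝ u z I := by
  have h := deriv_vert hharm z.re z.im hz
  have h2 := h.hasDerivWithinAt (s := Ioi 0)
  have h3 : MonotoneOn (fun s : ℝ => u ⟨z.re, s⟩) (Ioi 0) := by
    intro a ha b hb hab
    exact hmono _ _ _ ha hab
  have h4 := h3.derivWithin_nonneg (x := z.im)
  rwa [h2.derivWithin (isOpen_Ioi.uniqueDiffWithinAt hz)] at h4

/-- `W` monotone from Schwarz-Pick -/
theorem W_mono {P : ℂ → ℂ} (hP : ∀ z : ℂ, 0 < z.im → DifferentiableAt ℂ P z)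
    (hpos : ∀ z : ℂ, 0 < z.im → 0 ≤ (P z).im) (x y1 y2 : ℝ) (hy1 : 0 < y1) (hy : y1 ≤ y2) :
    y1 * (P ⟨x, y1⟩).im ≤ y2 * (P ⟨x, y2⟩).im := by
  rcases hy.eq_or_lt with rfl | hlt
  · exact le_rfl
  have hy2 : 0 < y2 := hy1.trans hlt
  have h := schwarz_pick hP hpos (z := ⟨x, y1⟩) (w := ⟨x, y2⟩) hy1 hy2
  have e : ‖(⟨x, y1⟩ : ℂ) - ⟨x, y2⟩‖ ^ 2 = (y1 - y2) ^ 2 := by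
    simp [Complex.sq_norm, Complex.normSq_apply]; ring
  rw [e] at h
  have ha := hpos ⟨x, y1⟩ hy1
  have hb := hpos ⟨x, y2⟩ hy2
  set a := (P ⟨x, y1⟩).im
  set b := (P ⟨x, y2⟩).im
  have h1 : (a - b) ^ 2 ≤ ‖P ⟨x, y1⟩ - P ⟨x, y2⟩‖ ^ 2 := by
    rw [← sq_abs (a - b)]
    exact pow_le_pow_left₀ (abs_nonneg _) (by
      have := Complex.abs_im_le_norm (P ⟨x, y1⟩ - P ⟨x, y2⟩)
      rwa [Complex.sub_im] at this) 2
  have h2 : (a - b) ^ 2 * (y1 * y2) ≤ a * b * (y1 - y2) ^ 2 :=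
    (mul_le_mul_of_nonneg_right h1 (by positivity)).trans h
  -- (a y1 - b y2)(a y2 - b y1) ≤ 0
  have h3 : (a * y1 - b * y2) * (a * y2 - b * y1) ≤ 0 := by nlinarith
  by_contra hcon
  push Not at hcon
  have h4 : 0 < a * y1 - b * y2 := by linarith
  have h5 : a * y2 - b * y1 ≤ 0 := by
    by_contra h6
    push Not at h6
    have := mul_pos h4 h6
    linarith
  nlinarith

theorem slope_bounds {u : ℂ → ℝ}
    (hharm : ∀ z : ℂ, z.im ≠ 0 → InnerProductSpace.HarmonicAt u z)
    (hW : ∀ x y1 y2 : ℝ, 0 < y1 → y1 ≤ y2 →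
      y1 * fderiv ℝ u ⟨x, y1⟩ I ≤ y2 * fderiv ℝ u ⟨x, y2⟩ I)
    (x y Y : ℝ) (hy : 0 < y) (hyY : y ≤ Y) :
    y * fderiv ℝ u ⟨x, y⟩ I * (Real.log Y - Real.log y) ≤ u ⟨x, Y⟩ - u ⟨x, y⟩ ∧
    u ⟨x, Y⟩ - u ⟨x, y⟩ ≤ Y * fderiv ℝ u ⟨x, Y⟩ I * (Real.log Y - Real.log y) := by
  have hder : ∀ c s : ℝ, 0 < s → HasDerivAt (fun s : ℝ => u ⟨x, s⟩ - c * Real.log s)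
      (fderiv ℝ u ⟨x, s⟩ I - c * s⁻¹) s := by
    intro c s hs
    exact (deriv_vert hharm x s hs).sub ((Real.hasDerivAt_log hs.ne').const_mul c)
  have hpos : ∀ s ∈ Icc y Y, 0 < s := fun s hs => hy.trans_le hs.1
  constructor
  · set c := y * fderiv ℝ u ⟨x, y⟩ I with hc
    have hm : MonotoneOn (fun s : ℝ => u ⟨x, s⟩ - c * Real.log s) (Icc y Y) := by
      apply monotoneOn_of_deriv_nonneg (convex_Icc y Y)
      · intro s hs
        exact (hder c s (hpos s hs)).continuousAt.continuousWithinAt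
      · intro s hs
        exact (hder c s (hpos s (interior_subset hs))).differentiableAt.differentiableWithinAt
      · intro s hs
        have hs' := interior_subset hs
        rw [(hder c s (hpos s hs')).deriv]
        have h0 := hpos s hs'
        have h1 : c ≤ s * fderiv ℝ u ⟨x, s⟩ I := hW x y s hy hs'.1
        have : c * s⁻¹ ≤ s * fderiv ℝ u ⟨x, s⟩ I * s⁻¹ :=
          mul_le_mul_of_nonneg_right h1 (by positivity)
        have e : s * fderiv ℝ u ⟨x, s⟩ I * s⁻¹ = fderiv ℝ u ⟨x, s⟩ I := by field_simp
        linarith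
    have := hm (left_mem_Icc.2 hyY) (right_mem_Icc.2 hyY) hyY
    simp only at this
    linarith
  · set c := Y * fderiv ℝ u ⟨x, Y⟩ I with hc
    have hm : AntitoneOn (fun s : ℝ => u ⟨x, s⟩ - c * Real.log s) (Icc y Y) := by
      apply antitoneOn_of_deriv_nonpos (convex_Icc y Y)
      · intro s hs
        exact (hder c s (hpos s hs)).continuousAt.continuousWithinAt
      · intro s hs
        exact (hder c s (hpos s (interior_subset hs))).differentiableAt.differentiableWithinAt
      · intro s hs
        have hs' := interior_subset hs
        rw [(hder c s (hpos s hs')).deriv]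
        have h0 := hpos s hs'
        have h1 : s * fderiv ℝ u ⟨x, s⟩ I ≤ c := hW x s Y h0 hs'.2
        have : s * fderiv ℝ u ⟨x, s⟩ I * s⁻¹ ≤ c * s⁻¹ :=
          mul_le_mul_of_nonneg_right h1 (by positivity)
        have e : s * fderiv ℝ u ⟨x, s⟩ I * s⁻¹ = fderiv ℝ u ⟨x, s⟩ I := by field_simp
        linarith
    have := hm (left_mem_Icc.2 hyY) (right_mem_Icc.2 hyY) hyY
    simp only at this
    linarith
theorem core_v {P : ℂ → ℂ} (hP : ∀ z : ℂ, 0 < z.im → DifferentiableAt ℂ P z)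
    (hpos : ∀ z : ℂ, 0 < z.im → 0 < (P z).im) {K : ℝ} (hK : 0 < K)
    (hle : ∀ y : ℝ, 0 < y → y * (P ⟨0, y⟩).im ≤ K)
    (hfr : ∀ ε : ℝ, 0 < ε → ∃ᶠ Y : ℝ in atTop, ‖P ⟨0, Y⟩‖ < ε) (z : ℂ) (hz : 0 < z.im) :
    ‖P z‖ ^ 2 * z.im ≤ K * (P z).im := by
  have hV := hpos z hz
  have hn : 0 < ‖P z‖ := by
    apply norm_pos_iff.2
    intro h
    rw [h] at hV
    simp at hV
  have key : ∀ δ : ℝ, 0 < δ → δ < ‖P z‖ →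
      0 ≤ K * (P z).im * (1 + δ) ^ 2 - (‖P z‖ - δ) ^ 2 * z.im := by
    intro δ hδ hδ2
    obtain ⟨Y, hY1, hY2⟩ := ((hfr δ hδ).and_eventually (eventually_ge_atTop (max 1 (‖z‖ / δ)))).exists
    have hY3 : 1 ≤ Y := le_trans (le_max_left _ _) hY2
    have hY4 : ‖z‖ / δ ≤ Y := le_trans (le_max_right _ _) hY2
    have hY0 : 0 < Y := by linarith
    rw [div_le_iff₀ hδ] at hY4
    have hs := schwarz_pick hP (fun z hz => (hpos z hz).le) hz (w := ⟨0, Y⟩) hY0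
    have hw := hle Y hY0
    have hnw : ‖z - ⟨0, Y⟩‖ ≤ Y * (1 + δ) := by
      have h1 := norm_sub_le z ⟨0, Y⟩
      have h2 : ‖(⟨0, Y⟩ : ℂ)‖ = Y := by
        have : (⟨0, Y⟩ : ℂ) = (Y : ℂ) * I := by apply Complex.ext <;> simp
        rw [this]; simp [abs_of_pos hY0]
      rw [h2] at h1
      linarith
    have hlow : ‖P z‖ - δ ≤ ‖P z - P ⟨0, Y⟩‖ := by
      have := norm_sub_norm_le (P z) (P ⟨0, Y⟩)
      linarith
    have hlow2 : (‖P z‖ - δ) ^ 2 ≤ ‖P z - P ⟨0, Y⟩‖ ^ 2 := by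
      apply pow_le_pow_left₀ (by linarith) hlow
    have hnw2 : ‖z - ⟨0, Y⟩‖ ^ 2 ≤ (Y * (1 + δ)) ^ 2 := pow_le_pow_left₀ (norm_nonneg _) hnw 2
    have hVw := (hpos ⟨0, Y⟩ hY0).le
    have h3 : (‖P z‖ - δ) ^ 2 * (z.im * Y) ≤ (P z).im * (P ⟨0, Y⟩).im * (Y * (1 + δ)) ^ 2 := by
      calc _ ≤ ‖P z - P ⟨0, Y⟩‖ ^ 2 * (z.im * Y) := by gcongr
        _ ≤ _ := hs
        _ ≤ _ := by gcongr
    have h4 : (P z).im * (P ⟨0, Y⟩).im * (Y * (1 + δ)) ^ 2 ≤ (P z).im * K * Y * (1 + δ) ^ 2 := by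
      have : (P z).im * (P ⟨0, Y⟩).im * (Y * (1 + δ)) ^ 2 =
        ((P z).im * Y * (1 + δ) ^ 2) * (Y * (P ⟨0, Y⟩).im) := by ring
      rw [this]
      calc _ ≤ ((P z).im * Y * (1 + δ) ^ 2) * K := by gcongr
        _ = _ := by ring
    have h5 : 0 ≤ (K * (P z).im * (1 + δ) ^ 2 - (‖P z‖ - δ) ^ 2 * z.im) * Y := by nlinarith
    exact nonneg_of_mul_nonneg_left h5 hY0
  have hcont : Tendsto (fun δ : ℝ => K * (P z).im * (1 + δ) ^ 2 - (‖P z‖ - δ) ^ 2 * z.im)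
      (nhdsWithin 0 (Ioi 0)) (nhds (K * (P z).im * (1 + 0) ^ 2 - (‖P z‖ - 0) ^ 2 * z.im)) := by
    apply Tendsto.mono_left _ nhdsWithin_le_nhds
    apply Continuous.tendsto (f := fun δ : ℝ => K * (P z).im * (1 + δ) ^ 2 - (‖P z‖ - δ) ^ 2 * z.im)
    fun_prop
  have := ge_of_tendsto hcont (b := 0) (by
    filter_upwards [Ioo_mem_nhdsGT hn] with δ hδ
    exact key δ hδ.1 hδ.2)
  simp at this
  linarith

theorem ninv_im (p : ℂ) : (-1 / p).im = p.im / ‖p‖ ^ 2 := by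
  rw [← Complex.normSq_eq_norm_sq]
  simp [Complex.div_im]
  ring

theorem ninv_re (p : ℂ) : (-1 / p).re = - p.re / ‖p‖ ^ 2 := by
  rw [← Complex.normSq_eq_norm_sq]
  simp [Complex.div_re]

theorem core_ix {P : ℂ → ℂ} (hP : ∀ z : ℂ, 0 < z.im → DifferentiableAt ℂ P z)
    (hpos : ∀ z : ℂ, 0 < z.im → 0 < (P z).im) {K : ℝ} (hK : 0 < K)
    (hle : ∀ y : ℝ, 0 < y → y * (P ⟨0, y⟩).im ≤ K)
    (hlim : ∀ L : ℝ, L < K → ∃ y0 : ℝ, 0 < y0 ∧ L < y0 * (P ⟨0, y0⟩).im)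
    (hv : ∀ z : ℂ, 0 < z.im → ‖P z‖ ^ 2 * z.im ≤ K * (P z).im) (s : ℝ) (hs : 1 ≤ s) :
    ∃ Y0 : ℝ, 0 < Y0 ∧ ∀ y p : ℝ, Y0 ≤ y → |p| = s * y → y * (P ⟨p, y⟩).im ≤ 6 * K / s ^ 2 := by
  have hPne : ∀ z : ℂ, 0 < z.im → P z ≠ 0 := by
    intro z hz h
    have := hpos z hz
    rw [h] at this
    simp at this
  set N : ℂ → ℂ := fun z => -1 / P z - z / K with hN
  have hNd : ∀ z : ℂ, 0 < z.im → DifferentiableAt ℂ N z := by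
    intro z hz
    exact ((differentiableAt_const _).div (hP z hz) (hPne z hz)).sub (differentiableAt_id.div_const _)
  have hNim : ∀ z : ℂ, (N z).im = (P z).im / ‖P z‖ ^ 2 - z.im / K := by
    intro z
    simp only [hN, Complex.sub_im, ninv_im, Complex.div_ofReal_im]
  have hNre : ∀ z : ℂ, (N z).re = - (P z).re / ‖P z‖ ^ 2 - z.re / K := by
    intro z
    simp only [hN, Complex.sub_re, ninv_re, Complex.div_ofReal_re]
  have hNpos : ∀ z : ℂ, 0 < z.im → 0 ≤ (N z).im := by
    intro z hz
    rw [hNim, sub_nonneg]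
    have h1 := hv z hz
    have h2 : 0 < ‖P z‖ ^ 2 := by have := norm_pos_iff.2 (hPne z hz); positivity
    rw [div_le_div_iff₀ hK h2]
    linarith
  -- estimate on the imaginary axis
  set T : ℝ := 3 + s ^ 2 with hT
  have hT0 : 0 < T := by positivity
  set η : ℝ := 1 / (2 * K * T) with hη
  have hη0 : 0 < η := by positivity
  have hax : ∃ Y0 : ℝ, 0 < Y0 ∧ ∀ y : ℝ, Y0 ≤ y → ‖N ⟨0, y⟩‖ ≤ η * y := by
    -- choose the threshold
    have hc1 : Tendsto (fun L : ℝ => (1 / L - 1 / K) + Real.sqrt (K / L ^ 3 - 1 / L ^ 2))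
        (nhdsWithin K (Iio K)) (nhds ((1 / K - 1 / K) + Real.sqrt (K / K ^ 3 - 1 / K ^ 2))) := by
      apply Tendsto.mono_left _ nhdsWithin_le_nhds
      have : ContinuousAt (fun L : ℝ => (1 / L - 1 / K) + Real.sqrt (K / L ^ 3 - 1 / L ^ 2)) K := by
        have : K ≠ 0 := hK.ne'
        have h3 : K ^ 3 ≠ 0 := by positivity
        have h2 : K ^ 2 ≠ 0 := by positivity
        fun_prop (disch := assumption)
      exact this
    have h0 : (1 / K - 1 / K) + Real.sqrt (K / K ^ 3 - 1 / K ^ 2) = 0 := by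
      have : K / K ^ 3 - 1 / K ^ 2 = 0 := by field_simp; norm_num
      rw [this]; simp
    rw [h0] at hc1
    obtain ⟨L, hL1, hL2, hL3⟩ := ((hc1.eventually (gt_mem_nhds hη0)).and
      (Ioo_mem_nhdsLT (show (0:ℝ) < K from hK))).exists
    obtain ⟨Y0, hY0, hLY⟩ := hlim L hL3
    refine ⟨Y0, hY0, fun y hy => ?_⟩
    have hy0 : 0 < y := by linarith
    have hW := W_mono hP (fun z hz => (hpos z hz).le) 0 Y0 y hY0 hy
    have hV := hpos ⟨0, y⟩ hy0
    set V := (P ⟨0, y⟩).im with hVdef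
    have hLW : L ≤ y * V := by linarith
    have hWK := hle y hy0
    rw [← hVdef] at hWK
    have hvz := hv ⟨0, y⟩ hy0
    simp only at hvz
    rw [← hVdef] at hvz
    have hn2 : ‖P ⟨0, y⟩‖ ^ 2 = (P ⟨0, y⟩).re ^ 2 + V ^ 2 := by
      rw [← Complex.normSq_eq_norm_sq, Complex.normSq_apply]; ring
    have hVle : V ^ 2 ≤ ‖P ⟨0, y⟩‖ ^ 2 := by rw [hn2]; nlinarith [sq_nonneg (P ⟨0, y⟩).re]
    have hn2pos : 0 < ‖P ⟨0, y⟩‖ ^ 2 := lt_of_lt_of_le (by positivity) hVle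
    have him : (N ⟨0, y⟩).im ≤ y * (1 / L - 1 / K) := by
      rw [hNim]
      simp only
      rw [← hVdef]
      have h1 : V / ‖P ⟨0, y⟩‖ ^ 2 ≤ V / V ^ 2 := by gcongr
      have h2 : V / V ^ 2 = 1 / V := by field_simp
      have h3 : 1 / V ≤ y / L := by
        rw [div_le_div_iff₀ hV hL2]; linarith
      have : y * (1 / L - 1 / K) = y / L - y / K := by ring
      rw [this]; linarith
    have hre : |(N ⟨0, y⟩).re| ≤ y * Real.sqrt (K / L ^ 3 - 1 / L ^ 2) := by
      rw [hNre]
      simp only [zero_div, sub_zero]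
      have hR : (P ⟨0, y⟩).re ^ 2 ≤ K * V / y - V ^ 2 := by
        rw [hn2] at hvz
        have : K * V / y = (K * V) / y := rfl
        rw [le_sub_iff_add_le, le_div_iff₀ hy0]
        exact hvz
      have hsq : (-(P ⟨0, y⟩).re / ‖P ⟨0, y⟩‖ ^ 2) ^ 2 ≤ y ^ 2 * (K / L ^ 3 - 1 / L ^ 2) := by
        rw [div_pow, neg_sq]
        have e1 : (P ⟨0, y⟩).re ^ 2 / (‖P ⟨0, y⟩‖ ^ 2) ^ 2 ≤ (K * V / y - V ^ 2) / (V ^ 2) ^ 2 := by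
          apply div_le_div₀ (le_trans (sq_nonneg _) hR) hR (by positivity)
          gcongr
        have e2 : (K * V / y - V ^ 2) / (V ^ 2) ^ 2 =
            y ^ 2 * ((K - y * V) * (1 / (y * V)) ^ 3) := by
          field_simp
        have e3 : (K - y * V) * (1 / (y * V)) ^ 3 ≤ (K - L) * (1 / L) ^ 3 := by
          have : 1 / (y * V) ≤ 1 / L := by gcongr
          gcongr
        have e4 : (K - L) * (1 / L) ^ 3 = K / L ^ 3 - 1 / L ^ 2 := by field_simp
        rw [e2] at e1
        rw [e4] at e3
        exact e1.trans (by gcongr)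
      calc |-(P ⟨0, y⟩).re / ‖P ⟨0, y⟩‖ ^ 2| ≤ Real.sqrt (y ^ 2 * (K / L ^ 3 - 1 / L ^ 2)) :=
            Real.abs_le_sqrt hsq
        _ = _ := by rw [Real.sqrt_mul (by positivity), Real.sqrt_sq hy0.le]
    have := Complex.norm_le_abs_re_add_abs_im (N ⟨0, y⟩)
    rw [abs_of_nonneg (hNpos _ hy0)] at this
    nlinarith
  obtain ⟨Y0, hY0, hY⟩ := hax
  refine ⟨Y0, hY0, fun y p hy hp => ?_⟩
  have hy0 : 0 < y := by linarith
  have hb := hY y hy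
  have hsp := schwarz_pick hNd hNpos (z := ⟨p, y⟩) (w := ⟨0, y⟩) hy0 hy0
  have hdist : ‖(⟨p, y⟩ : ℂ) - ⟨0, y⟩‖ = s * y := by
    have : (⟨p, y⟩ : ℂ) - ⟨0, y⟩ = (p : ℂ) := by apply Complex.ext <;> simp
    rw [this, Complex.norm_real, Real.norm_eq_abs, hp]
  rw [hdist] at hsp
  simp only at hsp
  set A := N ⟨p, y⟩ with hA
  set B := N ⟨0, y⟩ with hB
  have ha : 0 ≤ A.im := hNpos _ hy0
  have hb0 : 0 ≤ B.im := hNpos _ hy0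
  have hsp2 : ‖A - B‖ ^ 2 ≤ A.im * B.im * s ^ 2 := by
    have : (‖A - B‖ ^ 2) * y ^ 2 ≤ (A.im * B.im * s ^ 2) * y ^ 2 := by nlinarith
    exact le_of_mul_le_mul_right this (by positivity)
  have him : (A.im - B.im) ^ 2 ≤ ‖A - B‖ ^ 2 := by
    rw [← sq_abs (A.im - B.im), ← Complex.sub_im]
    exact pow_le_pow_left₀ (abs_nonneg _) (Complex.abs_im_le_norm _) 2
  have haB : A.im ≤ (2 + s ^ 2) * B.im := by
    by_contra! hcon
    have hapos : 0 < A.im := lt_of_le_of_lt (by positivity) hcon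
    nlinarith [sq_nonneg B.im, mul_pos hapos (sub_pos.2 hcon)]
  have hBn : B.im ≤ ‖B‖ := le_trans (le_abs_self _) (Complex.abs_im_le_norm B)
  have hAB : ‖A - B‖ ≤ (2 + s ^ 2) * ‖B‖ := by
    refine le_of_sq_le_sq ?_ (by positivity)
    calc ‖A - B‖ ^ 2 ≤ A.im * B.im * s ^ 2 := hsp2
      _ ≤ ((2 + s ^ 2) * ‖B‖) * ‖B‖ * (2 + s ^ 2) := by
          gcongr
          · exact haB.trans (by gcongr)
          · linarith
      _ = _ := by ring
  have hAn : ‖A‖ ≤ y / (2 * K) := by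
    have h1 : ‖A‖ ≤ ‖A - B‖ + ‖B‖ := by
      have := norm_add_le (A - B) B
      simpa using this
    calc ‖A‖ ≤ T * ‖B‖ := by rw [hT]; linarith
      _ ≤ T * (η * y) := by gcongr
      _ = y / (2 * K) := by rw [hη]; field_simp
  -- G = -1/P
  set G := -1 / P ⟨p, y⟩ with hG
  have hGA : G = A + (⟨p, y⟩ : ℂ) / K := by rw [hA, hN, hG]; simp only [sub_add_cancel]
  have hGre : s * y / (2 * K) ≤ |G.re| := by
    have : G.re = A.re + p / K := by rw [hGA, Complex.add_re, Complex.div_ofReal_re]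
    have h2 : |p / K| ≤ |G.re| + |A.re| := by
      have : p / K = G.re - A.re := by rw [this]; ring
      rw [this]; exact abs_sub _ _
    rw [abs_div, hp, abs_of_pos hK] at h2
    have h3 := (Complex.abs_re_le_norm A).trans hAn
    have h4 : y / (2 * K) ≤ s * y / (2 * K) := by
      gcongr; nlinarith
    have h5 : s * y / K = s * y / (2 * K) + s * y / (2 * K) := by field_simp; norm_num
    linarith
  have hGim : G.im ≤ 3 * y / (2 * K) := by
    have : G.im = A.im + y / K := by rw [hGA, Complex.add_im, Complex.div_ofReal_im]
    have h3 := ((le_abs_self _).trans (Complex.abs_im_le_norm A)).trans hAn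
    have h5 : 3 * y / (2 * K) = y / (2 * K) + y / K := by field_simp; norm_num
    linarith
  have hPG : P ⟨p, y⟩ = -1 / G := by
    rw [hG]; field_simp [hPne ⟨p, y⟩ hy0]
  have hPim : (P ⟨p, y⟩).im = G.im / ‖G‖ ^ 2 := by rw [hPG, ninv_im]
  have hGn : (s * y / (2 * K)) ^ 2 ≤ ‖G‖ ^ 2 := by
    apply pow_le_pow_left₀ (by positivity)
    exact hGre.trans (Complex.abs_re_le_norm G)
  rw [hPim]
  have hs0 : 0 < s := by linarith
  calc y * (G.im / ‖G‖ ^ 2) ≤ y * ((3 * y / (2 * K)) / (s * y / (2 * K)) ^ 2) := by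
        gcongr
    _ = _ := by field_simp; norm_num
theorem setup {u : ℂ → ℝ} (hu : Continuous u)
    (hh : ∀ z : ℂ, 0 < u z → InnerProductSpace.HarmonicAt u z)
    (hharm : ∀ z : ℂ, z.im ≠ 0 → InnerProductSpace.HarmonicAt u z)
    (hpos : ∀ z : ℂ, 0 ≤ u z) (hpos' : ∀ z : ℂ, z.im ≠ 0 → 0 < u z)
    (hsymm : ∀ z : ℂ, u (starRingEnd ℂ z) = u z)
    {A : ℝ} (hA : 0 ≤ A) (hgr : ∀ z : ℂ, u z ≤ A * (1 + ‖z‖)) {K0 : ℝ} (hK0 : 0 ≤ K0)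
    (hfr : ∃ᶠ R : ℝ in atTop, u ⟨0, R⟩ ≤ K0 * Real.log R) {x0 : ℝ} (hx0 : u (x0 : ℂ) = 0) :
    ∃ K : ℝ, 0 < K ∧ (∀ x y1 y2 : ℝ, 0 < y1 → y1 ≤ y2 →
      y1 * fderiv ℝ u ⟨x, y1⟩ I ≤ y2 * fderiv ℝ u ⟨x, y2⟩ I) ∧
      (∀ z : ℂ, 0 < z.im → |fderiv ℝ u z 1| ≤ K / z.im) ∧
      (∃ y0 : ℝ, 0 < y0 ∧ K / 2 ≤ y0 * fderiv ℝ u ⟨0, y0⟩ I) ∧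
      (∀ s : ℝ, 1 ≤ s → ∃ Y0 : ℝ, 0 < Y0 ∧ ∀ y p : ℝ, Y0 ≤ y → |p| = s * y →
        y * fderiv ℝ u ⟨p, y⟩ I ≤ 6 * K / s ^ 2) := by
  have hmono := mono_u hu hh hharm hpos hsymm hA hgr hK0 hfr
  have hV0 := V_nonneg hharm hmono
  set P : ℂ → ℂ := fun z => -((fderiv ℝ u z 1 : ℝ) - I * (fderiv ℝ u z I : ℝ) : ℂ) with hPdef
  have hPim : ∀ z, (P z).im = fderiv ℝ u z I := by intro z; simp [hPdef]
  have hPre : ∀ z, (P z).re = -fderiv ℝ u z 1 := by intro z; simp [hPdef]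
  have hP : ∀ z : ℂ, 0 < z.im → DifferentiableAt ℂ P z := by
    intro z hz
    have := HarmonicAt.differentiableAt_complex_partial (hharm z hz.ne')
    exact this.neg
  have hPnn : ∀ z : ℂ, 0 < z.im → 0 ≤ (P z).im := by
    intro z hz; rw [hPim]; exact hV0 z hz
  have hW : ∀ x y1 y2 : ℝ, 0 < y1 → y1 ≤ y2 →
      y1 * fderiv ℝ u ⟨x, y1⟩ I ≤ y2 * fderiv ℝ u ⟨x, y2⟩ I := by
    intro x y1 y2 h1 h2
    have := W_mono hP hPnn x y1 y2 h1 h2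
    rwa [hPim, hPim] at this
  -- positivity
  have hPpos : ∀ z : ℂ, 0 < z.im → 0 < (P z).im := by
    intro w hw
    rcases (hPnn w hw).lt_or_eq with h | h
    · exact h
    exfalso
    have hall : ∀ z : ℂ, 0 < z.im → fderiv ℝ u z I = 0 := by
      intro z hz
      have h1 := schwarz_pick hP hPnn hz hw
      rw [← h] at h1
      simp only [mul_zero, zero_mul] at h1
      have h2 : ‖P z - P w‖ ^ 2 ≤ 0 := by
        by_contra! h3
        have : 0 < ‖P z - P w‖ ^ 2 * (z.im * w.im) := by positivity
        linarith
      have h3 : ‖P z - P w‖ = 0 := by nlinarith [norm_nonneg (P z - P w)]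
      have h4 : P z = P w := by rwa [norm_eq_zero, sub_eq_zero] at h3
      rw [← hPim, h4, ← h]
    have hconst : ∀ y : ℝ, 0 < y → y ≤ 1 → u ⟨x0, 1⟩ ≤ u ⟨x0, y⟩ := by
      intro y hy hy1
      have := (slope_bounds hharm hW x0 y 1 hy hy1).2
      rw [hall ⟨x0, 1⟩ one_pos] at this
      simp at this
      linarith
    have hcont : Tendsto (fun y : ℝ => u ⟨x0, y⟩) (nhdsWithin 0 (Ioi 0)) (nhds (u ⟨x0, 0⟩)) := by
      apply Tendsto.mono_left _ nhdsWithin_le_nhds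
      have : Continuous (fun y : ℝ => u ⟨x0, y⟩) := by
        have h2 : (fun y : ℝ => u ⟨x0, y⟩) = fun y : ℝ => u ((x0 : ℂ) + y * I) := by
          funext y; congr 1; apply Complex.ext <;> simp
        rw [h2]; fun_prop
      exact this.tendsto 0
    have h5 := ge_of_tendsto hcont (b := u ⟨x0, 1⟩) (by
      filter_upwards [Ioo_mem_nhdsGT (one_pos : (0:ℝ) < 1)] with y hy
      exact hconst y hy.1 hy.2.le)
    have h6 : u ⟨x0, 0⟩ = 0 := hx0
    have h7 := hpos' ⟨x0, 1⟩ (by simp)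
    linarith
  -- bound
  have hbd : ∀ y : ℝ, 0 < y → y * (P ⟨0, y⟩).im ≤ K0 := by
    intro y hy
    by_contra! hcon
    set w := y * (P ⟨0, y⟩).im with hw
    have hev : ∀ᶠ Y : ℝ in atTop, w * Real.log y < (w - K0) * Real.log Y :=
      (Real.tendsto_log_atTop.const_mul_atTop (sub_pos.2 hcon)).eventually_gt_atTop _
    obtain ⟨Y, h1, h2, h3⟩ := (hfr.and_eventually (hev.and (eventually_ge_atTop y))).exists
    have h4 := (slope_bounds hharm hW 0 y Y hy h3).1
    rw [← hPim, ← hw] at h4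
    have := hpos ⟨0, y⟩
    nlinarith
  -- sup
  set S : Set ℝ := (fun y : ℝ => y * (P ⟨0, y⟩).im) '' Ioi 0 with hS
  have hSb : BddAbove S := ⟨K0, by rintro _ ⟨y, hy, rfl⟩; exact hbd y hy⟩
  have hSn : S.Nonempty := ⟨_, 1, mem_Ioi.2 one_pos, rfl⟩
  set K := sSup S with hKdef
  have hle : ∀ y : ℝ, 0 < y → y * (P ⟨0, y⟩).im ≤ K := fun y hy => le_csSup hSb ⟨y, hy, rfl⟩
  have hlim : ∀ L : ℝ, L < K → ∃ y0 : ℝ, 0 < y0 ∧ L < y0 * (P ⟨0, y0⟩).im := by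
    intro L hL
    obtain ⟨_, ⟨y, hy, rfl⟩, h⟩ := exists_lt_of_lt_csSup hSn hL
    exact ⟨y, hy, h⟩
  have hK : 0 < K := by
    have := hle 1 one_pos
    have h2 := hPpos ⟨0, 1⟩ one_pos
    linarith
  have hPfr : ∀ ε : ℝ, 0 < ε → ∃ᶠ Y : ℝ in atTop, ‖P ⟨0, Y⟩‖ < ε := by
    intro ε hε
    have hl : Tendsto (fun R : ℝ => 16 * K0 * (Real.log R / R)) atTop (nhds 0) := by
      simpa using log_div_tendsto.const_mul (16 * K0)
    have hev := hl.eventually (gt_mem_nhds hε)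
    refine (hfr.and_eventually (hev.and (eventually_gt_atTop 0))).mono ?_
    rintro Y ⟨h1, h2, h3⟩
    have hg := grad_est hharm hpos (c := ⟨0, Y⟩) h3
    have e1 : |fderiv ℝ u ⟨0, Y⟩ 1| ≤ ‖fderiv ℝ u ⟨0, Y⟩‖ := by
      have := (fderiv ℝ u ⟨0, Y⟩).le_opNorm 1
      simpa using this
    have e2 : |fderiv ℝ u ⟨0, Y⟩ I| ≤ ‖fderiv ℝ u ⟨0, Y⟩‖ := by
      have := (fderiv ℝ u ⟨0, Y⟩).le_opNorm I
      simpa using this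
    have e3 := Complex.norm_le_abs_re_add_abs_im (P ⟨0, Y⟩)
    rw [hPre, hPim, abs_neg] at e3
    have e4 : 8 * u ⟨0, Y⟩ / Y ≤ 8 * K0 * (Real.log Y / Y) := by
      rw [div_le_iff₀ h3]
      have : 8 * K0 * (Real.log Y / Y) * Y = 8 * (K0 * Real.log Y) := by field_simp
      rw [this]; linarith
    simp only at hg
    linarith
  have hv := core_v hP hPpos hK hle hPfr
  refine ⟨K, hK, hW, ?_, ?_, ?_⟩
  · intro z hz
    have h1 := hv z hz
    have h2 : (P z).im ≤ ‖P z‖ := (le_abs_self _).trans (Complex.abs_im_le_norm _)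
    have h3 : 0 < ‖P z‖ := lt_of_lt_of_le (hPpos z hz) h2
    have h4 : ‖P z‖ ≤ K / z.im := by
      rw [le_div_iff₀ hz]
      have : ‖P z‖ * (‖P z‖ * z.im) ≤ ‖P z‖ * K := by nlinarith
      exact le_of_mul_le_mul_left this h3
    have h5 := Complex.abs_re_le_norm (P z)
    rw [hPre, abs_neg] at h5
    linarith
  · obtain ⟨y0, h1, h2⟩ := hlim (K / 2) (by linarith)
    rw [hPim] at h2
    exact ⟨y0, h1, h2.le⟩
  · intro s hs
    obtain ⟨Y0, h1, h2⟩ := core_ix hP hPpos hK hle hlim hv s hs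
    refine ⟨Y0, h1, fun y p hy hp => ?_⟩
    have := h2 y p hy hp
    rwa [hPim] at this
theorem interval_est {u : ℂ → ℝ} (hu : Continuous u)
    (hharm : ∀ z : ℂ, z.im ≠ 0 → InnerProductSpace.HarmonicAt u z)
    {A : ℝ} (hA : 0 ≤ A) (hgr : ∀ z : ℂ, u z ≤ A * (1 + ‖z‖)) {a b c M D : ℝ} (hab : a < b)
    (hzero : ∀ x ∈ Icc a b, u ((x : ℝ) : ℂ) = 0) (hc : 0 < c) (hD : 0 ≤ D)
    (hDd : D ≤ |(a + b) / 2|) (hlen : c * (1 + D) ^ (-M) ≤ b - a) :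
    ∃ r : ℝ, 0 < r ∧ r ≤ 1 ∧ u ⟨(a + b) / 2, r⟩ ≤ 2 * A ∧
      Real.log (min 1 (c / 2)) - (|M| + 1) * Real.log (2 + |(a + b) / 2|) ≤ Real.log r := by
  set p := (a + b) / 2 with hp
  set d := |p| with hd
  have hd0 : 0 ≤ d := abs_nonneg _
  set ρ := min 1 ((b - a) / 2) with hρ
  have hρ0 : 0 < ρ := lt_min one_pos (by linarith)
  have hρ1 : ρ ≤ 1 := min_le_left _ _
  have hρ2 : ρ ≤ (b - a) / 2 := min_le_right _ _
  have hc' : 0 < min 1 (c / 2) := lt_min one_pos (by linarith)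
  have hlow : min 1 (c / 2) * (2 + d) ^ (-|M|) ≤ ρ := by
    have q0 : 0 < (2 + d) ^ (-|M|) := Real.rpow_pos_of_pos (by linarith) _
    apply le_min
    · have h1 : (2 + d) ^ (-|M|) ≤ 1 :=
        Real.rpow_le_one_of_one_le_of_nonpos (by linarith) (by linarith [abs_nonneg M])
      have h2 : min 1 (c / 2) ≤ 1 := min_le_left _ _
      nlinarith
    · have h1 : (2 + d) ^ (-|M|) ≤ (1 + D) ^ (-|M|) :=
        Real.rpow_le_rpow_of_nonpos (by linarith) (by linarith) (by linarith [abs_nonneg M])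
      have h2 : (1 + D) ^ (-|M|) ≤ (1 + D) ^ (-M) :=
        Real.rpow_le_rpow_of_exponent_le (by linarith) (by linarith [le_abs_self M])
      have h3 : min 1 (c / 2) ≤ c / 2 := min_le_right _ _
      have h4 : c * (2 + d) ^ (-|M|) ≤ c * (1 + D) ^ (-M) := by
        apply mul_le_mul_of_nonneg_left (h1.trans h2) hc.le
      nlinarith
  refine ⟨ρ / (2 + d), by positivity, ?_, ?_, ?_⟩
  · rw [div_le_one (by linarith)]; linarith
  · have h := half_disc hu hharm (p := p) (ρ := ρ) (S := A * (2 + d)) hρ0 (by positivity) ?_ ?_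
      (y := ρ / (2 + d)) (by positivity) (div_le_self hρ0.le (by linarith))
    · have e : 2 * (A * (2 + d)) * (ρ / (2 + d) / ρ) = 2 * A := by field_simp
      rwa [e] at h
    · intro x hx
      apply hzero
      have := abs_le.1 hx
      constructor <;> linarith [this.1, this.2]
    · intro z hz
      have h1 : ‖z‖ ≤ ‖z - p‖ + ‖(p : ℂ)‖ := by
        have := norm_add_le (z - p) (p : ℂ)
        simpa using this
      rw [Complex.norm_real, Real.norm_eq_abs, ← hd] at h1
      refine (hgr z).trans ?_
      apply mul_le_mul_of_nonneg_left _ hA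
      linarith
  · have h2d : 0 < 2 + d := by linarith
    rw [Real.log_div hρ0.ne' h2d.ne']
    have h1 := Real.log_le_log (by positivity) hlow
    rw [Real.log_mul hc'.ne' (Real.rpow_pos_of_pos h2d _).ne', Real.log_rpow h2d] at h1
    linarith

set_option maxHeartbeats 1000000 in
theorem stmt12 (a b : ℕ → ℝ) (hab : ∀ m, a m < b m)
    (hdisj : ∀ m n, m ≠ n → Disjoint (Icc (a m) (b m)) (Icc (a n) (b n)))
    (hdist : Tendsto (fun m => Metric.infDist (0 : ℝ) (Icc (a m) (b m))) atTop atTop)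
    (E : Set ℝ) (hE : E = ⋃ m, Icc (a m) (b m))
    (c M : ℝ) (hc : 0 < c)
    (hlen : ∀ m, c * (1 + Metric.infDist (0 : ℝ) (Icc (a m) (b m))) ^ (-M) ≤ b m - a m)
    (u : ℂ → ℝ) (hu_cont : Continuous u)
    (hu_zero : ∀ x ∈ E, u (x : ℂ) = 0)
    (hu_pos : ∀ z ∈ (cplx E)ᶜ, 0 < u z)
    (hu_harm : HarmonicOn u (cplx E)ᶜ)
    (hu_symm : ∀ z : ℂ, u (starRingEnd ℂ z) = u z)
    (hu_growth : ∃ A : ℝ, ∀ z : ℂ, u z ≤ A * (1 + ‖z‖)) :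
    Tendsto (fun y : ℝ => Real.log y / u ((y : ℂ) * Complex.I)) atTop (nhds 0) := by
  have hzero' : ∀ z ∈ cplx E, u z = 0 := by
    rintro _ ⟨x, hx, rfl⟩
    exact hu_zero x hx
  have hpos : ∀ z, 0 ≤ u z := by
    intro z
    by_cases hz : z ∈ cplx E
    · exact (hzero' z hz).ge
    · exact (hu_pos z hz).le
  have hset : (cplx E)ᶜ = {z | 0 < u z} := by
    ext z
    constructor
    · exact fun hz => hu_pos z hz
    · intro hz hz2
      have h1 : 0 < u z := hz
      rw [hzero' z hz2] at h1
      exact lt_irrefl _ h1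
  have hopen : IsOpen (cplx E)ᶜ := by
    rw [hset]
    exact isOpen_lt continuous_const hu_cont
  have hh : ∀ z : ℂ, 0 < u z → InnerProductSpace.HarmonicAt u z := by
    intro z hz
    apply harm_bridge hopen hu_harm
    rw [hset]
    exact hz
  have hpos' : ∀ z : ℂ, z.im ≠ 0 → 0 < u z := by
    intro z hz
    apply hu_pos
    rintro ⟨x, _, rfl⟩
    simp at hz
  have hharm : ∀ z : ℂ, z.im ≠ 0 → InnerProductSpace.HarmonicAt u z :=
    fun z hz => hh z (hpos' z hz)
  obtain ⟨A, hA, hgr⟩ : ∃ A : ℝ, 0 ≤ A ∧ ∀ z : ℂ, u z ≤ A * (1 + ‖z‖) := by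
    obtain ⟨A, h⟩ := hu_growth
    refine ⟨|A|, abs_nonneg _, fun z => (h z).trans ?_⟩
    exact mul_le_mul_of_nonneg_right (le_abs_self A) (by positivity)
  have hEm : ∀ m, ∀ x ∈ Icc (a m) (b m), u ((x : ℝ) : ℂ) = 0 := by
    intro m x hx
    apply hu_zero
    rw [hE]
    exact mem_iUnion.2 ⟨m, hx⟩
  have hI : ∀ y : ℝ, (y : ℂ) * Complex.I = ⟨0, y⟩ := by
    intro y; apply Complex.ext <;> simp
  by_contra hnot
  obtain ⟨K0, hK0, hfr⟩ : ∃ K0 : ℝ, 0 ≤ K0 ∧ ∃ᶠ R : ℝ in atTop, u ⟨0, R⟩ ≤ K0 * Real.log R := by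
    rw [Metric.tendsto_nhds] at hnot
    push Not at hnot
    obtain ⟨ε, hε, hf⟩ := hnot
    refine ⟨1 / ε, by positivity, ?_⟩
    refine (hf.and_eventually (eventually_ge_atTop 1)).mono ?_
    rintro y ⟨h1, h2⟩
    have hup : 0 < u ⟨0, y⟩ := hpos' _ (by simp only; linarith)
    have hl : 0 ≤ Real.log y := Real.log_nonneg h2
    rw [hI, Real.dist_eq, sub_zero, abs_of_nonneg (by positivity), le_div_iff₀ hup] at h1
    rw [one_div, ← div_eq_inv_mul, le_div_iff₀ hε]
    linarith
  obtain ⟨K, hK, hW, hux, ⟨y0, hy0, hKy0⟩, hix⟩ := setup hu_cont hh hharm hpos hpos' hu_symm hA hgr hK0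
    hfr (hEm 0 (a 0) ⟨le_rfl, (hab 0).le⟩)
  set k : ℝ := |M| + 1 with hk
  have hk1 : 1 ≤ k := by have := abs_nonneg M; linarith
  set s : ℝ := 24 * (k + 1) with hs
  have hs1 : 1 ≤ s := by linarith
  have hs0 : 0 < s := by linarith
  obtain ⟨Y0, hY0, hY⟩ := hix s hs1
  set C : ℝ := K * s + 2 * A + K / 2 * (Real.log s + Real.log y0) +
    K / (4 * (k + 1)) * (k * Real.log 3 - Real.log (min 1 (c / 2))) with hC
  have hDd : ∀ m, Metric.infDist (0 : ℝ) (Icc (a m) (b m)) ≤ |(a m + b m) / 2| := by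
    intro m
    have h1 : (a m + b m) / 2 ∈ Icc (a m) (b m) := by
      have := hab m
      constructor <;> linarith
    have := Metric.infDist_le_dist_of_mem (x := (0:ℝ)) h1
    rwa [Real.dist_eq, zero_sub, abs_neg] at this
  have hdt : Tendsto (fun m => |(a m + b m) / 2|) atTop atTop := tendsto_atTop_mono hDd hdist
  have hlt : Tendsto (fun m => K / 4 * Real.log (|(a m + b m) / 2|)) atTop atTop :=
    (Real.tendsto_log_atTop.comp hdt).const_mul_atTop (by positivity)
  obtain ⟨m, hm1, hm2, hm3, hm4⟩ := ((hlt.eventually_gt_atTop C).and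
    ((hdt.eventually_ge_atTop s).and ((hdt.eventually_ge_atTop (s * Y0)).and
      (hdt.eventually_ge_atTop (s * y0))))).exists
  obtain ⟨r, hr0, hr1, hur, hlr⟩ := interval_est hu_cont hharm hA hgr (hab m) (hEm m) hc
    Metric.infDist_nonneg (hDd m) (hlen m)
  set p := (a m + b m) / 2 with hp
  set d := |p| with hd
  have hd1 : 1 ≤ d := by linarith
  have hd0 : 0 < d := by linarith
  set y := d / s with hy
  have hy1 : 1 ≤ y := by rw [hy, le_div_iff₀ hs0]; linarith
  have hyY : Y0 ≤ y := by rw [hy, le_div_iff₀ hs0]; linarith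
  have hyy : y0 ≤ y := by rw [hy, le_div_iff₀ hs0]; linarith
  have hyp : 0 < y := by linarith
  have hds : d = s * y := by rw [hy]; field_simp
  have h1 := hY y p hyY hds
  have h2 := (slope_bounds hharm hW p r y hr0 (by linarith)).2
  have h3 := (slope_bounds hharm hW 0 y0 y hy0 hyy).1
  have hlogy : Real.log y = Real.log d - Real.log s := by
    rw [hy, Real.log_div hd0.ne' hs0.ne']
  have hls : 0 ≤ Real.log s := Real.log_nonneg hs1
  have hly0 : Real.log y0 ≤ Real.log y := Real.log_le_log hy0 hyy
  have hlr0 : Real.log r ≤ Real.log y := Real.log_le_log hr0 (by linarith)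
  -- horizontal comparison
  have h4 : u ⟨0, y⟩ ≤ u ⟨p, y⟩ + K * s := by
    have hmv := Convex.norm_image_sub_le_of_norm_hasDerivWithin_le
      (f := fun t : ℝ => u ⟨t, y⟩) (f' := fun t : ℝ => fderiv ℝ u ⟨t, y⟩ 1) (s := Set.univ)
      (C := K / y) (x := p) (y := 0)
      (fun t _ => (deriv_horiz hharm t y hyp).hasDerivWithinAt)
      (fun t _ => by
        rw [Real.norm_eq_abs]
        exact hux ⟨t, y⟩ hyp) convex_univ (mem_univ _) (mem_univ _)
    rw [Real.norm_eq_abs, Real.norm_eq_abs, zero_sub, abs_neg, ← hd, hds] at hmv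
    have e : K / y * (s * y) = K * s := by field_simp
    rw [e] at hmv
    have := le_of_abs_le hmv
    linarith
  -- bounding the slope
  have h5 : 6 * K / s ^ 2 ≤ K / (4 * (k + 1)) := by
    rw [div_le_div_iff₀ (by positivity) (by positivity)]
    have : 24 * (k + 1) ≤ s ^ 2 := by rw [← hs]; nlinarith
    nlinarith
  have h6 : u ⟨p, y⟩ ≤ 2 * A + K / (4 * (k + 1)) * (Real.log y - Real.log r) := by
    have e1 : y * fderiv ℝ u ⟨p, y⟩ I * (Real.log y - Real.log r) ≤
        K / (4 * (k + 1)) * (Real.log y - Real.log r) :=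
      mul_le_mul_of_nonneg_right (h1.trans h5) (by linarith)
    linarith
  have h7 : K / 2 * (Real.log y - Real.log y0) ≤ u ⟨0, y⟩ := by
    have e1 : K / 2 * (Real.log y - Real.log y0) ≤
        y0 * fderiv ℝ u ⟨0, y0⟩ I * (Real.log y - Real.log y0) :=
      mul_le_mul_of_nonneg_right hKy0 (by linarith)
    have := hpos ⟨0, y0⟩
    linarith
  have h8 : Real.log (2 + d) ≤ Real.log 3 + Real.log d := by
    rw [← Real.log_mul (by norm_num) hd0.ne']
    exact Real.log_le_log (by linarith) (by linarith)
  have h9 : Real.log y - Real.log r ≤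
      (k + 1) * Real.log d + (k * Real.log 3 - Real.log (min 1 (c / 2))) := by
    have : k * Real.log (2 + d) ≤ k * (Real.log 3 + Real.log d) := by gcongr
    linarith
  have h10 : K / (4 * (k + 1)) * (Real.log y - Real.log r) ≤
      K / 4 * Real.log d + K / (4 * (k + 1)) * (k * Real.log 3 - Real.log (min 1 (c / 2))) := by
    have hk2 : 0 < k + 1 := by linarith
    calc _ ≤ K / (4 * (k + 1)) *
          ((k + 1) * Real.log d + (k * Real.log 3 - Real.log (min 1 (c / 2)))) :=
          mul_le_mul_of_nonneg_left h9 (by positivity)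
      _ = _ := by
          rw [mul_add, ← mul_assoc]
          congr 2
          generalize k + 1 = q at hk2 ⊢
          field_simp
  rw [hlogy] at h7
  rw [hC] at hm1
  linarith
end

section
/- Let W be a weight. Then the following are equivalent: (1) the polynomials are dense in C(W); (2) sup_{P ∈ X_W} ∫_ℝ log⁺|P(x)|/(1+x²) dx = +∞; (3) ∫_ℝ log M_W(x)/(1+x²) dx = +∞. -/
open Complex Filter Set MeasureTheory
open scoped ENNReal

noncomputable def logPlus (t : ℝ) : ℝ := max (Real.log t) 0

/-- `W` is a weight: lower semicontinuous, `≥ 1`, dominating all powers,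
and finite on a set with a finite accumulation point. -/
def IsWeight (W : ℝ → ℝ≥0∞) : Prop :=
  LowerSemicontinuous W ∧ (∀ x, 1 ≤ W x) ∧
  (∀ n : ℕ, Tendsto (fun x : ℝ => ENNReal.ofReal (|x| ^ n) / W x)
    (comap (fun x : ℝ => |x|) atTop) (nhds 0)) ∧
  ∃ x₀ : ℝ, AccPt x₀ (Filter.principal {x | W x ≠ ⊤})

/-- Membership in the space `C(W)`. -/
def MemCW (W : ℝ → ℝ≥0∞) (f : ℝ → ℂ) : Prop :=
  Continuous f ∧
  Tendsto (fun x : ℝ => ENNReal.ofReal (‖f x‖) / W x)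
    (comap (fun x : ℝ => |x|) atTop) (nhds 0)

/-- The norm of `C(W)`. -/
noncomputable def normCW (W : ℝ → ℝ≥0∞) (f : ℝ → ℂ) : ℝ≥0∞ :=
  ⨆ x : ℝ, ENNReal.ofReal (‖f x‖) / W x

/-- The polynomials are dense in `C(W)`. -/
def PolyDense (W : ℝ → ℝ≥0∞) : Prop :=
  ∀ f : ℝ → ℂ, MemCW W f → ∀ ε : ℝ, 0 < ε →
    ∃ P : Polynomial ℂ, normCW W (fun x => f x - P.eval (x : ℂ)) < ENNReal.ofReal ε

/-- The unit ball `X_W`: polynomials bounded by `W` on `ℝ`. -/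
def XW (W : ℝ → ℝ≥0∞) : Set (Polynomial ℂ) :=
  {P | ∀ x : ℝ, ENNReal.ofReal (‖P.eval (x : ℂ)‖) ≤ W x}

/-- The Hall majorant `M_W`. -/
noncomputable def MW (W : ℝ → ℝ≥0∞) (z : ℂ) : ℝ≥0∞ :=
  ⨆ P ∈ XW W, ENNReal.ofReal (‖P.eval z‖)

/-- Logarithm on `[1,+∞]`, with `elog ⊤ = ⊤`. -/
noncomputable def elog (w : ℝ≥0∞) : ℝ≥0∞ :=
  if w = ⊤ then ⊤ else ENNReal.ofReal (Real.log w.toReal)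


/-- kernel -/
noncomputable def kk (t : ℝ) : ℝ≥0∞ := ENNReal.ofReal ((1 + t ^ 2)⁻¹)

lemma measurable_kk : Measurable kk := by unfold kk; fun_prop

lemma ofReal_integral_le_aux {α : Type*} [MeasurableSpace α] (μ : Measure α) (f : α → ℝ) :
    ENNReal.ofReal (∫ x, f x ∂μ) ≤ ∫⁻ x, ENNReal.ofReal (f x) ∂μ := by
  by_cases hf : Integrable f μ
  · have h1 : ∫ x, f x ∂μ ≤ ∫ x, max (f x) 0 ∂μ :=
      integral_mono hf hf.pos_part (fun x => le_max_left _ _)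
    refine (ENNReal.ofReal_le_ofReal h1).trans ?_
    rw [ofReal_integral_eq_lintegral_ofReal hf.pos_part
      (Eventually.of_forall fun x => le_max_right _ _)]
    refine lintegral_mono fun x => ?_
    simp
  · simp [integral_undef hf]

lemma circ_sub (g : ℝ → ℝ≥0∞) :
    ∫⁻ θ in Ioo 0 (2 * Real.pi), g θ =
      ∫⁻ t, 2 * kk t * g (2 * Real.arctan t + Real.pi) := by
  have h := lintegral_image_eq_lintegral_abs_deriv_mul (s := univ)
    (f := fun t => 2 * Real.arctan t + Real.pi) (f' := fun t => 2 * (1 / (1 + t ^ 2)))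
    MeasurableSet.univ
    (fun x _ => (((Real.hasDerivAt_arctan x).const_mul 2).add_const Real.pi).hasDerivWithinAt)
    (fun x _ y _ hxy => Real.arctan_injective (by simpa using hxy)) g
  have himg : (fun t => 2 * Real.arctan t + Real.pi) '' univ = Ioo 0 (2 * Real.pi) := by
    ext θ
    constructor
    · rintro ⟨t, -, rfl⟩
      have h1 := Real.neg_pi_div_two_lt_arctan t
      have h2 := Real.arctan_lt_pi_div_two t
      constructor <;> simp only <;> linarith
    · rintro ⟨h1, h2⟩
      refine ⟨Real.tan ((θ - Real.pi) / 2), trivial, ?_⟩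
      simp only
      rw [Real.arctan_tan (by linarith) (by linarith)]
      ring
  rw [himg] at h
  rw [h, Measure.restrict_univ]
  refine lintegral_congr fun t => ?_
  congr 1
  rw [abs_of_nonneg (by positivity), ENNReal.ofReal_mul (by norm_num)]
  simp [kk]

lemma circ_pt (t : ℝ) : circleMap 0 1 (2 * Real.arctan t + Real.pi) = (t - I) / (t + I) := by
  have hne : (t : ℂ) + I ≠ 0 := by
    intro h; have := congrArg Complex.im h; simp at this
  have h1 : (1 : ℂ) + t ^ 2 ≠ 0 := by
    have : (0:ℝ) < 1 + t ^ 2 := by positivity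
    exact_mod_cast this.ne'
  have hs : (Real.sqrt (1 + t ^ 2) : ℂ) ^ 2 = 1 + t ^ 2 := by
    have : Real.sqrt (1 + t ^ 2) ^ 2 = 1 + t ^ 2 := Real.sq_sqrt (by positivity)
    exact_mod_cast this
  have hs0 : (Real.sqrt (1 + t ^ 2) : ℂ) ≠ 0 := by
    intro h; rw [h] at hs; apply h1; rw [← hs]; ring
  have he : Complex.exp (Real.arctan t * I) = (1 + t * I) / Real.sqrt (1 + t ^ 2) := by
    rw [Complex.exp_mul_I, ← Complex.ofReal_cos, ← Complex.ofReal_sin, Real.cos_arctan,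
      Real.sin_arctan]
    push_cast
    field_simp
  simp only [circleMap, Complex.ofReal_add, Complex.ofReal_mul, Complex.ofReal_ofNat,
    Complex.ofReal_one]
  rw [add_mul, Complex.exp_add, Complex.exp_pi_mul_I,
    show (2 * (Real.arctan t : ℂ) * I) = Real.arctan t * I + Real.arctan t * I by ring,
    Complex.exp_add, he, div_mul_div_comm, ← sq, ← sq, hs]
  rw [eq_div_iff hne]
  field_simp
  ring_nf
  simp [Complex.I_sq, show I ^ 3 = -I by rw [pow_succ, Complex.I_sq]; ring]
  ring

open Polynomial in
lemma poly_at_I (P : ℂ[X]) :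
    ENNReal.ofReal Real.pi * ENNReal.ofReal (Real.log ‖P.eval I‖) ≤
      ∫⁻ t : ℝ, ENNReal.ofReal (Real.log ‖P.eval (t : ℂ)‖) * kk t := by
  by_cases hP0 : P.eval I = 0
  · simp [hP0]
  set n := P.natDegree with hn
  set Q : ℂ[X] := ∑ k ∈ Finset.range (n + 1),
    C (P.coeff k * I ^ k) * (1 + X) ^ k * (1 - X) ^ (n - k) with hQ
  have hQ0 : Q.coeff 0 = P.eval I := by
    rw [coeff_zero_eq_eval_zero, hQ, eval_finsetSum, eval_eq_sum_range, ← hn]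
    simp
  have hQe : ∀ w : ℂ, w ≠ 1 → Q.eval w = (1 - w) ^ n * P.eval (I * (1 + w) / (1 - w)) := by
    intro w hw
    have hw' : 1 - w ≠ 0 := sub_ne_zero.2 hw.symm
    rw [hQ, eval_finsetSum, eval_eq_sum_range, Finset.mul_sum]
    refine Finset.sum_congr rfl fun k hk => ?_
    have hk' : k ≤ n := by simpa [Nat.lt_succ_iff] using hk
    simp only [eval_mul, eval_C, eval_pow, eval_add, eval_one, eval_X, eval_sub]
    rw [div_pow, mul_pow, ← Nat.sub_add_cancel hk', Nat.add_sub_cancel, pow_add]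
    field_simp
  have hQne : Q ≠ 0 := by
    intro h; rw [h] at hQ0; exact hP0 (by simpa using hQ0.symm)
  have hle : Real.log ‖P.eval I‖ ≤ Q.logMahlerMeasure := by
    have h := norm_coeff_le_choose_mul_mahlerMeasure 0 Q
    rw [hQ0] at h
    simp only [Nat.choose_zero_right, Nat.cast_one, one_mul] at h
    rw [logMahlerMeasure_eq_log_MahlerMeasure]
    exact Real.log_le_log (by positivity) h
  have hone : (X - C 1 : ℂ[X]).logMahlerMeasure = 0 := by
    rw [logMahlerMeasure_eq_log_MahlerMeasure, mahlerMeasure_X_sub_C]; simp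
  let D : ℝ → ℝ := fun θ => Real.log ‖Q.eval (circleMap 0 1 θ)‖ -
    n * Real.log ‖(X - C 1 : ℂ[X]).eval (circleMap 0 1 θ)‖
  have hDint : ∫ θ in (0:ℝ)..(2 * Real.pi), D θ = 2 * Real.pi * Q.logMahlerMeasure := by
    have h1 := Q.intervalIntegrable_mahlerMeasure
    have h2 := (X - C 1 : ℂ[X]).intervalIntegrable_mahlerMeasure
    have h3 : Q.logMahlerMeasure =
      (2 * Real.pi)⁻¹ * ∫ θ in (0:ℝ)..(2 * Real.pi), Real.log ‖Q.eval (circleMap 0 1 θ)‖ := by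
      rw [logMahlerMeasure_def, Real.circleAverage_def, smul_eq_mul]
    have h4 : (X - C 1 : ℂ[X]).logMahlerMeasure =
      (2 * Real.pi)⁻¹ * ∫ θ in (0:ℝ)..(2 * Real.pi),
        Real.log ‖(X - C 1 : ℂ[X]).eval (circleMap 0 1 θ)‖ := by
      rw [logMahlerMeasure_def, Real.circleAverage_def, smul_eq_mul]
    rw [hone] at h4
    have hpi := Real.pi_pos
    have h5 : ∫ θ in (0:ℝ)..(2 * Real.pi),
        Real.log ‖(X - C 1 : ℂ[X]).eval (circleMap 0 1 θ)‖ = 0 := by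
      have := mul_eq_zero.1 h4.symm
      rcases this with h | h
      · exact absurd h (by positivity)
      · exact h
    simp only [D]
    rw [intervalIntegral.integral_sub h1 (h2.const_mul _), intervalIntegral.integral_const_mul,
      h5, h3]
    field_simp
    ring
  rw [intervalIntegral.integral_of_le (by positivity), integral_Ioc_eq_integral_Ioo] at hDint
  have hmain : ENNReal.ofReal (2 * Real.pi * Real.log ‖P.eval I‖) ≤
      ∫⁻ θ in Ioo 0 (2 * Real.pi), ENNReal.ofReal (D θ) := by
    refine le_trans (ENNReal.ofReal_le_ofReal ?_) (ofReal_integral_le_aux _ D)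
    rw [hDint]
    have := Real.pi_pos
    gcongr
  rw [circ_sub] at hmain
  have hfin : ∀ᵐ t : ℝ, Q.eval (circleMap 0 1 (2 * Real.arctan t + Real.pi)) ≠ 0 := by
    have hc : ({z : ℂ | Q.eval z = 0}).Countable := by
      have : {z : ℂ | Q.eval z = 0} = (Q.roots.toFinset : Set ℂ) := by
        ext z; simp [hQne]
      rw [this]; exact Finset.countable_toSet _
    have hc2 := hc.preimage_of_injOn (f := fun t : ℝ =>
      circleMap 0 1 (2 * Real.arctan t + Real.pi)) (by
        intro x _ y _ hxy
        simp only [circ_pt] at hxy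
        have hx : (x : ℂ) + I ≠ 0 := by
          intro h; have := congrArg Complex.im h; simp at this
        have hy : (y : ℂ) + I ≠ 0 := by
          intro h; have := congrArg Complex.im h; simp at this
        rw [div_eq_div_iff hx hy] at hxy
        have h2 : (2 * I) * ((x : ℂ) - y) = 0 := by linear_combination hxy
        have h3 : (x : ℂ) - y = 0 := by
          rcases mul_eq_zero.1 h2 with h | h
          · simp at h
          · exact h
        exact_mod_cast sub_eq_zero.1 h3)
    exact hc2.ae_notMem _
  have hmono : ∫⁻ t, 2 * kk t * ENNReal.ofReal (D (2 * Real.arctan t + Real.pi)) ≤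
      ∫⁻ t : ℝ, 2 * (ENNReal.ofReal (Real.log ‖P.eval (t : ℂ)‖) * kk t) := by
    refine lintegral_mono_ae ?_
    filter_upwards [hfin] with t ht
    rw [mul_assoc, mul_comm (kk t)]
    gcongr
    apply le_of_eq
    simp only [D]
    have hx : (t : ℂ) + I ≠ 0 := by
      intro h; have := congrArg Complex.im h; simp at this
    rw [circ_pt] at ht ⊢
    set w : ℂ := (t - I) / (t + I) with hw
    have h1w : 1 - w = 2 * I / (t + I) := by rw [hw]; field_simp; ring
    have h1w0 : 1 - w ≠ 0 := by rw [h1w]; simp [hx]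
    have hw1 : w ≠ 1 := fun h => h1w0 (by rw [h]; ring)
    have hphi : I * (1 + w) / (1 - w) = t := by
      rw [div_eq_iff h1w0, h1w, hw]; field_simp; ring
    rw [hQe w hw1, hphi] at ht ⊢
    have hPt : P.eval (t : ℂ) ≠ 0 := right_ne_zero_of_mul ht
    rw [norm_mul, norm_pow, Real.log_mul (by simpa using fun h => absurd h h1w0)
      (by simpa using hPt), Real.log_pow]
    simp only [eval_sub, eval_X, eval_C]
    rw [norm_sub_rev w 1]
    ring
  have h := hmain.trans hmono
  rw [lintegral_const_mul' _ _ (by simp), mul_assoc, ENNReal.ofReal_mul (by norm_num),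
    ENNReal.ofReal_mul Real.pi_pos.le] at h
  simp only [ENNReal.ofReal_ofNat] at h
  exact (ENNReal.mul_le_mul_iff_right (by simp) (by simp)).1 h

noncomputable def LP (P : Polynomial ℂ) (z : ℂ) : ℝ≥0∞ := ENNReal.ofReal (Real.log ‖P.eval z‖)

lemma measurable_LP (P : Polynomial ℂ) : Measurable (LP P) := by
  unfold LP
  have : Continuous fun z : ℂ => P.eval z := P.continuous
  exact ENNReal.measurable_ofReal.comp (Real.measurable_log.comp this.norm.measurable)

lemma poly_aff (P : Polynomial ℂ) (α β : ℂ) :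
    LP P (α + β * I) ≤ ∫⁻ t : ℝ, LP P (α + β * t) * kk t := by
  have h := poly_at_I (P.comp (Polynomial.C α + Polynomial.C β * Polynomial.X))
  simp only [Polynomial.eval_comp, Polynomial.eval_add, Polynomial.eval_mul, Polynomial.eval_C,
    Polynomial.eval_X] at h
  refine le_trans ?_ h
  have : (1 : ℝ≥0∞) ≤ ENNReal.ofReal Real.pi := by
    rw [ENNReal.one_le_ofReal]; linarith [Real.pi_gt_three]
  calc LP P (α + β * I) = 1 * LP P (α + β * I) := (one_mul _).symm
    _ ≤ _ := by unfold LP; gcongr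

lemma lintegral_aff (g : ℝ → ℝ≥0∞) (a c : ℝ) (hc : c ≠ 0) :
    ∫⁻ s, g s = ENNReal.ofReal |c| * ∫⁻ t, g (a + c * t) := by
  have h := lintegral_image_eq_lintegral_abs_deriv_mul (s := univ)
    (f := fun t => a + c * t) (f' := fun t => c * 1)
    MeasurableSet.univ
    (fun x _ => (((hasDerivAt_id x).const_mul c).const_add a).hasDerivWithinAt)
    (fun x _ y _ hxy => by simpa [hc] using hxy) g
  have himg : (fun t => a + c * t) '' univ = univ := by
    ext θ
    simp only [mem_image, mem_univ, true_and, iff_true]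
    exact ⟨(θ - a) / c, by field_simp; ring⟩
  rw [himg] at h
  simp only [Measure.restrict_univ, mul_one] at h
  rw [h, lintegral_const_mul' _ _ (by simp)]

lemma kk_le (C s u : ℝ) (h : 1 + s ^ 2 ≤ C * (1 + u ^ 2)) : kk u ≤ ENNReal.ofReal C * kk s := by
  have hC : 0 ≤ C := by
    by_contra hneg
    push Not at hneg
    nlinarith [sq_nonneg s, sq_nonneg u]
  unfold kk
  rw [← ENNReal.ofReal_mul hC]
  apply ENNReal.ofReal_le_ofReal
  rw [← div_eq_mul_inv, le_div_iff₀ (by positivity), inv_mul_le_iff₀ (by positivity)]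
  linarith

lemma K1 (h : ℝ → ℝ≥0∞) (a c : ℝ) (hc : c ≠ 0) :
    ENNReal.ofReal |c| * ∫⁻ t, h (a + c * t) * kk t ≤
      ENNReal.ofReal (1 + 2 * a ^ 2 + 2 * c ^ 2) * ∫⁻ s, h s * kk s := by
  have h1 := lintegral_aff (fun s => h s * kk ((s - a) / c)) a c hc
  have h2 : ∀ t, (a + c * t - a) / c = t := fun t => by field_simp; ring
  simp only [h2] at h1
  rw [← h1, ← lintegral_const_mul' _ _ (by simp)]
  refine lintegral_mono fun s => ?_
  have := kk_le (1 + 2 * a ^ 2 + 2 * c ^ 2) s ((s - a) / c) (by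
    have hs : s = a + c * ((s - a) / c) := by field_simp; ring
    set u := (s - a) / c
    rw [hs]
    nlinarith [sq_nonneg (a - c * u), sq_nonneg (a * u), sq_nonneg u, sq_nonneg a, sq_nonneg c])
  calc h s * kk ((s - a) / c) ≤ h s * (ENNReal.ofReal (1 + 2 * a ^ 2 + 2 * c ^ 2) * kk s) := by
        gcongr
    _ = _ := by ring

lemma lintegral_kk : ∫⁻ t, kk t ≠ ⊤ := by
  have := integrable_inv_one_add_sq
  have h := this.lintegral_lt_top
  exact h.ne

lemma K2 (c : ℝ) (hc : c ≠ 0) : ∃ C : ℝ≥0∞, C ≠ ⊤ ∧ ∀ h : ℝ → ℝ≥0∞, Measurable h →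
    ∫⁻ x, (∫⁻ t, h (x + c * t) * kk t) * kk x ≤ C * ∫⁻ s, h s * kk s := by
  have hc' : ENNReal.ofReal |c| ≠ 0 := by simpa using hc
  have hk := measurable_kk
  refine ⟨ENNReal.ofReal (2 + 2 * c ^ 2) * ((∫⁻ t, kk t) + (∫⁻ t, kk t) / ENNReal.ofReal |c|), ?_, ?_⟩
  · refine ENNReal.mul_ne_top (by simp) (ENNReal.add_ne_top.2 ⟨lintegral_kk, ?_⟩)
    exact ENNReal.div_ne_top lintegral_kk hc'
  intro h hh
  calc ∫⁻ x, (∫⁻ t, h (x + c * t) * kk t) * kk x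
      = ∫⁻ x, ∫⁻ t, h (x + c * t) * kk t * kk x := by
        refine lintegral_congr fun x => ?_
        rw [lintegral_mul_const' _ _ (by simp [kk])]
    _ = ∫⁻ t, ∫⁻ x, h (x + c * t) * kk t * kk x := by
        apply lintegral_lintegral_swap
        apply Measurable.aemeasurable
        simp only [Function.uncurry_def]
        fun_prop
    _ = ∫⁻ t, ∫⁻ s, h s * kk t * kk (s - c * t) := by
        refine lintegral_congr fun t => ?_
        rw [← lintegral_add_right_eq_self (fun s => h s * kk t * kk (s - c * t)) (c * t)]
        simp
    _ = ∫⁻ s, ∫⁻ t, h s * kk t * kk (s - c * t) := by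
        apply lintegral_lintegral_swap
        apply Measurable.aemeasurable
        simp only [Function.uncurry_def]
        fun_prop
    _ ≤ ∫⁻ s, ∫⁻ t, h s * kk s * (ENNReal.ofReal (2 + 2 * c ^ 2) * (kk t + kk (s - c * t))) := by
        refine lintegral_mono fun s => lintegral_mono fun t => ?_
        have key : kk t * kk (s - c * t) ≤
            kk s * (ENNReal.ofReal (2 + 2 * c ^ 2) * (kk t + kk (s - c * t))) := by
          unfold kk
          rw [← ENNReal.ofReal_add (by positivity) (by positivity),
            ← ENNReal.ofReal_mul (by positivity), ← ENNReal.ofReal_mul (by positivity),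
            ← ENNReal.ofReal_mul (by positivity)]
          apply ENNReal.ofReal_le_ofReal
          set u := s - c * t with hu
          have hs : s = u + c * t := by rw [hu]; ring
          have h1 : 1 + s ^ 2 ≤ (2 + 2 * c ^ 2) * ((1 + t ^ 2) + (1 + u ^ 2)) := by
            rw [hs]
            nlinarith [sq_nonneg (u - c * t), sq_nonneg (c * u), sq_nonneg u, sq_nonneg t,
              sq_nonneg c]
          have p1 : 0 < 1 + t ^ 2 := by positivity
          have p2 : 0 < 1 + u ^ 2 := by positivity
          have p3 : 0 < 1 + s ^ 2 := by positivity
          have e : (1 + s ^ 2)⁻¹ * ((2 + 2 * c ^ 2) * ((1 + t ^ 2)⁻¹ + (1 + u ^ 2)⁻¹)) =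
            ((2 + 2 * c ^ 2) * ((1 + t ^ 2) + (1 + u ^ 2))) / (1 + s ^ 2) *
              ((1 + t ^ 2)⁻¹ * (1 + u ^ 2)⁻¹) := by
            field_simp; ring
          rw [e]
          refine le_mul_of_one_le_left (by positivity) ?_
          rwa [one_le_div p3]
        calc h s * kk t * kk (s - c * t) = h s * (kk t * kk (s - c * t)) := by ring
          _ ≤ h s * (kk s * (ENNReal.ofReal (2 + 2 * c ^ 2) * (kk t + kk (s - c * t)))) := by
            gcongr
          _ = _ := by ring
    _ = ∫⁻ s, h s * kk s * (ENNReal.ofReal (2 + 2 * c ^ 2) *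
          ((∫⁻ t, kk t) + (∫⁻ t, kk t) / ENNReal.ofReal |c|)) := by
        refine lintegral_congr fun s => ?_
        rw [lintegral_const_mul _ (by fun_prop), lintegral_const_mul _ (by fun_prop),
          lintegral_add_left (by fun_prop)]
        congr 3
        have h1 := lintegral_aff kk s (-c) (neg_ne_zero.2 hc)
        rw [abs_neg] at h1
        rw [ENNReal.eq_div_iff hc' (by simp), h1]
        congr 2
        ext t
        congr 1
        ring
    _ = _ := by
        rw [lintegral_mul_const _ (by fun_prop), mul_comm]

lemma le_elog {a : ℝ} (ha : 0 ≤ a) {M : ℝ≥0∞} (h : ENNReal.ofReal a ≤ M) :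
    ENNReal.ofReal (Real.log a) ≤ elog M := by
  unfold elog
  split_ifs with hM
  · exact le_top
  · apply ENNReal.ofReal_le_ofReal_iff' |>.2
    rcases ha.eq_or_lt with rfl | h0
    · right; simp
    · left
      exact Real.log_le_log h0 ((ENNReal.ofReal_le_iff_le_toReal hM).1 h)

lemma LP_le_elog {W : ℝ → ℝ≥0∞} {P : Polynomial ℂ} (hP : P ∈ XW W) (z : ℂ) :
    LP P z ≤ elog (MW W z) := by
  refine le_elog (norm_nonneg _) ?_
  unfold MW
  exact le_iSup₂ (f := fun (P : Polynomial ℂ) (_ : P ∈ XW W) => ENNReal.ofReal ‖P.eval z‖) P hP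

lemma norm_le_of_LP {P : Polynomial ℂ} {z : ℂ} {B : ℝ≥0∞} (hB : B ≠ ⊤) (h : LP P z ≤ B) :
    ‖P.eval z‖ ≤ Real.exp B.toReal := by
  rcases (norm_nonneg (P.eval z)).eq_or_lt with h0 | h0
  · rw [← h0]; exact (Real.exp_pos _).le
  · rw [← Real.log_le_iff_le_exp h0]
    exact (ENNReal.ofReal_le_iff_le_toReal hB).1 h

lemma elog_MW_le {W : ℝ → ℝ≥0∞} {z : ℂ} {B : ℝ≥0∞} (h : ∀ P ∈ XW W, LP P z ≤ B) :
    elog (MW W z) ≤ B := by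
  by_cases hB : B = ⊤
  · simp [hB]
  have h1 : MW W z ≤ ENNReal.ofReal (Real.exp B.toReal) := by
    unfold MW
    exact iSup₂_le fun P hP => ENNReal.ofReal_le_ofReal (norm_le_of_LP hB (h P hP))
  have h2 : MW W z ≠ ⊤ := (h1.trans_lt ENNReal.ofReal_lt_top).ne
  unfold elog
  rw [if_neg h2]
  refine ENNReal.ofReal_le_of_le_toReal ?_
  rcases (ENNReal.toReal_nonneg (a := MW W z)).eq_or_lt with h0 | h0
  · rw [← h0]; simp
  · rw [Real.log_le_iff_le_exp h0]
    exact ENNReal.toReal_le_of_le_ofReal (Real.exp_pos _).le h1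

lemma ofReal_logPlus (P : Polynomial ℂ) (x : ℝ) :
    ENNReal.ofReal (logPlus ‖P.eval (x : ℂ)‖ / (1 + x ^ 2)) = LP P x * kk x := by
  unfold logPlus LP kk
  rw [div_eq_mul_inv, ENNReal.ofReal_mul (le_max_right _ _), ENNReal.ofReal_max]
  simp

lemma two_three (W : ℝ → ℝ≥0∞) :
    (⨆ P ∈ XW W, ENNReal.ofReal
        (∫ x : ℝ, logPlus (‖P.eval (x : ℂ)‖) / (1 + x ^ 2))) ≤
      (∫⁻ x : ℝ, elog (MW W x) / ENNReal.ofReal (1 + x ^ 2)) := by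
  refine iSup₂_le fun P hP => (ofReal_integral_le_aux _ _).trans (lintegral_mono fun x => ?_)
  simp only [ofReal_logPlus]
  rw [div_eq_mul_inv, kk, ENNReal.ofReal_inv_of_pos (by positivity)]
  gcongr
  exact LP_le_elog hP x

lemma poly_growth (P : Polynomial ℂ) : ∃ A : ℝ, 1 ≤ A ∧ ∀ x : ℝ,
    ‖P.eval (x : ℂ)‖ ≤ A * (1 + |x|) ^ P.natDegree := by
  refine ⟨1 + ∑ i ∈ Finset.range (P.natDegree + 1), ‖P.coeff i‖, ?_, fun x => ?_⟩
  · have : 0 ≤ ∑ i ∈ Finset.range (P.natDegree + 1), ‖P.coeff i‖ :=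
      Finset.sum_nonneg fun i _ => norm_nonneg _
    linarith
  rw [Polynomial.eval_eq_sum_range, add_mul, Finset.sum_mul]
  have : 0 ≤ 1 * (1 + |x|) ^ P.natDegree := by positivity
  refine le_trans ?_ (le_add_of_nonneg_left this)
  refine (norm_sum_le _ _).trans (Finset.sum_le_sum fun i hi => ?_)
  rw [norm_mul, norm_pow, Complex.norm_real, Real.norm_eq_abs]
  gcongr
  calc |x| ^ i ≤ (1 + |x|) ^ i := by gcongr; linarith
    _ ≤ _ := pow_le_pow_right₀ (by linarith [abs_nonneg x])
      (by simpa [Nat.lt_succ_iff] using hi)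

lemma integrable_logPlus (P : Polynomial ℂ) :
    Integrable (fun x : ℝ => logPlus (‖P.eval (x : ℂ)‖) / (1 + x ^ 2)) := by
  obtain ⟨A, hA, hgr⟩ := poly_growth P
  set n := P.natDegree
  have hbase : Integrable (fun x : ℝ => (1 + ‖x‖) ^ (-(3 / 2 : ℝ))) :=
    integrable_one_add_norm (by simp; norm_num)
  have hmeas : Measurable (fun x : ℝ => logPlus (‖P.eval (x : ℂ)‖) / (1 + x ^ 2)) := by
    have h1 : Continuous fun x : ℝ => P.eval (x : ℂ) := P.continuous.comp Complex.continuous_ofReal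
    unfold logPlus
    exact ((Real.measurable_log.comp h1.norm.measurable).max measurable_const).div (by fun_prop)
  refine (hbase.const_mul (2 * (Real.log A + 2 * n))).mono' hmeas.aestronglyMeasurable
    (Eventually.of_forall fun x => ?_)
  have hx1 : 1 ≤ 1 + |x| := by linarith [abs_nonneg x]
  have hx0 : 0 < 1 + |x| := by linarith
  have hlog0 : 0 ≤ Real.log (1 + |x|) := Real.log_nonneg hx1
  have hlogA : 0 ≤ Real.log A := Real.log_nonneg hA
  have hs1 : 1 ≤ Real.sqrt (1 + |x|) := by simpa using hx1
  have hlog : Real.log (1 + |x|) ≤ 2 * Real.sqrt (1 + |x|) := by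
    have := Real.log_le_sub_one_of_pos (Real.sqrt_pos.2 hx0)
    rw [Real.log_sqrt hx0.le] at this
    linarith
  have h1 : logPlus (‖P.eval (x : ℂ)‖) ≤ (Real.log A + 2 * n) * Real.sqrt (1 + |x|) := by
    have h2 : 0 ≤ (Real.log A + 2 * n) * Real.sqrt (1 + |x|) := by positivity
    unfold logPlus
    refine max_le ?_ h2
    rcases (norm_nonneg (P.eval (x:ℂ))).eq_or_lt with h0 | h0
    · rw [← h0]; simpa using h2
    · calc Real.log ‖P.eval (x : ℂ)‖ ≤ Real.log (A * (1 + |x|) ^ n) := Real.log_le_log h0 (hgr x)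
        _ = Real.log A + n * Real.log (1 + |x|) := by
          rw [Real.log_mul (by positivity) (by positivity), Real.log_pow]
        _ ≤ Real.log A * Real.sqrt (1 + |x|) + n * (2 * Real.sqrt (1 + |x|)) := by
          gcongr
          exact le_mul_of_one_le_right hlogA hs1
        _ = _ := by ring
  have h0 : 0 ≤ logPlus (‖P.eval (x : ℂ)‖) := le_max_right _ _
  rw [Real.norm_eq_abs, abs_of_nonneg (by positivity), Real.norm_eq_abs]
  have h3 : (1 + |x|) ^ (-(3 / 2 : ℝ)) = Real.sqrt (1 + |x|) / (1 + |x|) ^ 2 := by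
    rw [Real.sqrt_eq_rpow, ← Real.rpow_natCast, ← Real.rpow_sub hx0]
    norm_num
  rw [h3, div_le_iff₀ (by positivity)]
  have h4 : (1 + |x|) ^ 2 ≤ 2 * (1 + x ^ 2) := by
    nlinarith [sq_nonneg (1 - |x|), sq_abs x]
  calc _ ≤ (Real.log A + 2 * n) * Real.sqrt (1 + |x|) * 1 := by simpa using h1
    _ ≤ (Real.log A + 2 * n) * Real.sqrt (1 + |x|) * (2 * (1 + x ^ 2) / (1 + |x|) ^ 2) := by
      gcongr
      rwa [one_le_div (by positivity)]
    _ = _ := by ring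

lemma lintegral_LP (P : Polynomial ℂ) : ∫⁻ x : ℝ, LP P x * kk x =
    ENNReal.ofReal (∫ x : ℝ, logPlus (‖P.eval (x : ℂ)‖) / (1 + x ^ 2)) := by
  rw [ofReal_integral_eq_lintegral_ofReal (integrable_logPlus P)
    (Eventually.of_forall fun x => div_nonneg (le_max_right _ _) (by positivity))]
  exact lintegral_congr fun x => (ofReal_logPlus P x).symm

lemma local_bound (x₀ : ℝ) : ∃ C : ℝ≥0∞, C ≠ ⊤ ∧ ∀ P : Polynomial ℂ, ∀ z : ℂ,
    z ∈ Metric.ball (x₀ : ℂ) (1 / 2) → LP P z ≤ C * ∫⁻ x : ℝ, LP P x * kk x := by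
  obtain ⟨C, hC, hK2⟩ := K2 (-1) (by norm_num)
  refine ⟨2 * (ENNReal.ofReal (1 + 2 * (|x₀| + 1) ^ 2 + 2 * (3 / 2) ^ 2) * C), ?_, ?_⟩
  · exact ENNReal.mul_ne_top (by simp) (ENNReal.mul_ne_top (by simp) hC)
  intro P z hz
  rw [Metric.mem_ball, Complex.dist_eq] at hz
  have hre : |z.re - x₀| < 1 / 2 := by
    have := Complex.abs_re_le_norm (z - x₀); simp at this; linarith
  have him : |z.im| < 1 / 2 := by
    have := Complex.abs_im_le_norm (z - x₀); simp at this; linarith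
  rw [abs_lt] at hre him
  set a := z.re
  set c := z.im + 1 with hc
  have hc1 : 1 / 2 ≤ c := by rw [hc]; linarith
  have hc2 : c ≤ 3 / 2 := by rw [hc]; linarith
  have h1 : LP P z ≤ ∫⁻ t : ℝ, (fun s : ℝ => LP P (s - I)) (a + c * t) * kk t := by
    have := poly_aff P (a - I) c
    rw [show (a - I + c * I : ℂ) = z by
      rw [← Complex.re_add_im z, hc]; push_cast; ring] at this
    refine this.trans (le_of_eq ?_)
    refine lintegral_congr fun t => ?_
    simp only
    congr 2
    push_cast
    ring
  have h2 := K1 (fun s : ℝ => LP P (s - I)) a c (by linarith)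
  have h3 : ∫⁻ s : ℝ, LP P (s - I) * kk s ≤ C * ∫⁻ x : ℝ, LP P x * kk x := by
    refine le_trans (lintegral_mono fun s => ?_)
      (hK2 (fun x => LP P x) ((measurable_LP P).comp Complex.measurable_ofReal))
    gcongr
    have := poly_aff P s (-1)
    rw [show (s + -1 * I : ℂ) = s - I by ring] at this
    refine this.trans (le_of_eq ?_)
    refine lintegral_congr fun t => ?_
    simp
  have h4 : (1 : ℝ≥0∞) ≤ 2 * ENNReal.ofReal |c| := by
    rw [abs_of_nonneg (by linarith), show (2 : ℝ≥0∞) = ENNReal.ofReal 2 by simp,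
      ← ENNReal.ofReal_mul (by norm_num), ENNReal.one_le_ofReal]
    linarith
  calc LP P z ≤ 1 * ∫⁻ t : ℝ, (fun s : ℝ => LP P (s - I)) (a + c * t) * kk t := by
        rw [one_mul]; exact h1
    _ ≤ 2 * ENNReal.ofReal |c| * ∫⁻ t : ℝ, (fun s : ℝ => LP P (s - I)) (a + c * t) * kk t := by
        gcongr
    _ = 2 * (ENNReal.ofReal |c| * ∫⁻ t : ℝ, (fun s : ℝ => LP P (s - I)) (a + c * t) * kk t) := by
        ring
    _ ≤ 2 * (ENNReal.ofReal (1 + 2 * a ^ 2 + 2 * c ^ 2) *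
          ∫⁻ s : ℝ, (fun s : ℝ => LP P (s - I)) s * kk s) := by gcongr
    _ ≤ 2 * (ENNReal.ofReal (1 + 2 * (|x₀| + 1) ^ 2 + 2 * (3 / 2) ^ 2) *
          (C * ∫⁻ x : ℝ, LP P x * kk x)) := by
        have ha : a ^ 2 ≤ (|x₀| + 1) ^ 2 := by
          apply sq_le_sq'
          · linarith [neg_abs_le x₀]
          · linarith [le_abs_self x₀]
        gcongr
    _ = _ := by ring

lemma one_two (W : ℝ → ℝ≥0∞) (hW : IsWeight W) (hD : PolyDense W) :
    (⨆ P ∈ XW W, ENNReal.ofReal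
        (∫ x : ℝ, logPlus (‖P.eval (x : ℂ)‖) / (1 + x ^ 2))) = ⊤ := by
  by_contra hne
  obtain ⟨-, hW1, hWn, x₀, hacc⟩ := hW
  obtain ⟨C, hC, hloc⟩ := local_bound x₀
  set K := (⨆ P ∈ XW W, ENNReal.ofReal
        (∫ x : ℝ, logPlus (‖P.eval (x : ℂ)‖) / (1 + x ^ 2))) with hK
  have hCK : C * K ≠ ⊤ := ENNReal.mul_ne_top hC hne
  set B := Real.exp (C * K).toReal with hB
  have hBpos : 0 < B := Real.exp_pos _
  have hbd : ∀ P ∈ XW W, ∀ z ∈ Metric.ball (x₀ : ℂ) (1 / 2), ‖P.eval z‖ ≤ B := by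
    intro P hP z hz
    refine norm_le_of_LP hCK ((hloc P z hz).trans ?_)
    gcongr
    rw [lintegral_LP]
    exact le_iSup₂ (f := fun (P : Polynomial ℂ) (_ : P ∈ XW W) =>
      ENNReal.ofReal (∫ x : ℝ, logPlus (‖P.eval (x : ℂ)‖) / (1 + x ^ 2))) P hP
  let f : ℝ → ℂ := fun x => ((min (Real.sqrt |x - x₀|) 1 : ℝ) : ℂ)
  have hfn : ∀ x, ‖f x‖ ≤ 1 := by
    intro x
    simp only [f, Complex.norm_real, Real.norm_eq_abs]
    rw [abs_of_nonneg (by positivity)]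
    exact min_le_right _ _
  have hfm : MemCW W f := by
    refine ⟨by fun_prop, ?_⟩
    refine tendsto_of_tendsto_of_tendsto_of_le_of_le tendsto_const_nhds (hWn 0)
      (fun x => zero_le) (fun x => ?_)
    simp only [pow_zero]
    gcongr
    exact hfn x
  set L := 16 * B with hL
  have hLip : ∀ x y : ℝ, W x ≠ ⊤ → W y ≠ ⊤ → |x - x₀| < 1 / 4 → |y - x₀| < 1 / 4 →
      ‖f x - f y‖ ≤ L * |x - y| := by
    intro x y hx hy hx4 hy4
    refine le_of_forall_pos_le_add fun δ hδ => ?_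
    set S := (W x).toReal + (W y).toReal with hS
    have hSnn : 0 ≤ S := by positivity
    set ε := min 1 (δ / (S + 1)) with hε
    have hεpos : 0 < ε := by positivity
    obtain ⟨P, hP⟩ := hD f hfm ε hεpos
    have hpt : ∀ u, ENNReal.ofReal ‖f u - P.eval (u : ℂ)‖ ≤ ENNReal.ofReal ε * W u := by
      intro u
      have h1 : ENNReal.ofReal ‖f u - P.eval (u : ℂ)‖ / W u ≤ ENNReal.ofReal ε :=
        (le_iSup (fun u : ℝ => ENNReal.ofReal ‖f u - P.eval (u : ℂ)‖ / W u) u).trans hP.le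
      have hW0 : W u ≠ 0 := (lt_of_lt_of_le one_pos (hW1 u)).ne'
      by_cases ht : W u = ⊤
      · rw [ht, ENNReal.mul_top (by simpa using hεpos)]; exact le_top
      · rwa [ENNReal.div_le_iff hW0 ht] at h1
    have hpt' : ∀ u, W u ≠ ⊤ → ‖f u - P.eval (u : ℂ)‖ ≤ ε * (W u).toReal := by
      intro u hu
      have h1 := hpt u
      rw [← ENNReal.ofReal_toReal hu, ← ENNReal.ofReal_mul hεpos.le] at h1
      exact (ENNReal.ofReal_le_ofReal_iff (by positivity)).1 h1
    have hPX : Polynomial.C (1 / 2 : ℂ) * P ∈ XW W := by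
      intro u
      have h1 : ‖P.eval (u : ℂ)‖ ≤ 1 + ‖f u - P.eval (u : ℂ)‖ := by
        have h2 : P.eval (u : ℂ) = f u - (f u - P.eval (u : ℂ)) := by ring
        calc ‖P.eval (u : ℂ)‖ = ‖f u - (f u - P.eval (u : ℂ))‖ := by rw [← h2]
          _ ≤ ‖f u‖ + ‖f u - P.eval (u : ℂ)‖ := norm_sub_le _ _
          _ ≤ _ := by gcongr; exact hfn u
      have h3 : ENNReal.ofReal ‖P.eval (u : ℂ)‖ ≤ 2 * W u := by
        refine (ENNReal.ofReal_le_ofReal h1).trans ?_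
        rw [ENNReal.ofReal_add zero_le_one (norm_nonneg _), two_mul, ENNReal.ofReal_one]
        refine add_le_add (hW1 u) ((hpt u).trans ?_)
        calc ENNReal.ofReal ε * W u ≤ 1 * W u := by
              gcongr
              rw [ENNReal.ofReal_le_one]; exact min_le_left _ _
          _ = W u := one_mul _
      simp only [Polynomial.eval_mul, Polynomial.eval_C, norm_mul]
      rw [ENNReal.ofReal_mul (norm_nonneg _)]
      have h5 : ENNReal.ofReal ‖(1 / 2 : ℂ)‖ = 2⁻¹ := by
        simp
      rw [h5]
      calc _ ≤ 2⁻¹ * (2 * W u) := by gcongr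
        _ = W u := by rw [← mul_assoc, ENNReal.inv_mul_cancel (by simp) (by simp), one_mul]
    have hP2 : ∀ z ∈ Metric.ball (x₀ : ℂ) (1 / 2), ‖P.eval z‖ ≤ 2 * B := by
      intro z hz
      have h1 := hbd _ hPX z hz
      simp only [Polynomial.eval_mul, Polynomial.eval_C, norm_mul] at h1
      have h5 : ‖(1 / 2 : ℂ)‖ = 1 / 2 := by simp
      rw [h5] at h1
      linarith
    have hsub : Metric.ball (x : ℂ) (1 / 2 - 1 / 4) ⊆ Metric.ball (x₀ : ℂ) (1 / 2) := by
      apply Metric.ball_subset_ball'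
      rw [Complex.dist_eq, ← Complex.ofReal_sub, Complex.norm_real, Real.norm_eq_abs]
      linarith
    have hPxy : ‖P.eval (x : ℂ) - P.eval (y : ℂ)‖ ≤ L * |x - y| := by
      by_cases hxy : |x - y| < 1 / 4
      · have h1 := Complex.dist_le_div_mul_dist_of_mapsTo_ball (f := fun z => P.eval z)
          (c := (x : ℂ)) (z := (y : ℂ)) (R₁ := 1 / 2 - 1 / 4) (R₂ := 4 * B)
          P.differentiable.differentiableOn (fun z hz => by
            rw [Metric.mem_closedBall, dist_eq_norm]
            have h2 := hP2 z (hsub hz)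
            have h3 := hP2 x (hsub (Metric.mem_ball_self (by norm_num)))
            calc _ ≤ ‖P.eval z‖ + ‖P.eval (x : ℂ)‖ := norm_sub_le _ _
              _ ≤ _ := by linarith) (by
            rw [Metric.mem_ball, Complex.dist_eq, ← Complex.ofReal_sub, Complex.norm_real,
              Real.norm_eq_abs, abs_sub_comm]
            linarith)
        rw [dist_eq_norm, Complex.dist_eq, ← Complex.ofReal_sub, Complex.norm_real,
          Real.norm_eq_abs, abs_sub_comm, norm_sub_rev] at h1
        refine h1.trans (le_of_eq ?_)
        rw [hL]; ring
      · push Not at hxy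
        have h2 := hP2 x (hsub (Metric.mem_ball_self (by norm_num)))
        have h3 := hP2 y (by
          rw [Metric.mem_ball, Complex.dist_eq, ← Complex.ofReal_sub, Complex.norm_real,
              Real.norm_eq_abs]
          linarith)
        have := norm_sub_le (P.eval (x : ℂ)) (P.eval (y : ℂ))
        nlinarith
    have hx' := hpt' x hx
    have hy' := hpt' y hy
    have hεS : ε * S ≤ δ := by
      have h1 : ε ≤ δ / (S + 1) := min_le_right _ _
      calc ε * S ≤ δ / (S + 1) * (S + 1) := by gcongr; linarith
        _ = δ := by field_simp
    have htri : f x - f y = (f x - P.eval (x : ℂ)) + (P.eval (x : ℂ) - P.eval (y : ℂ))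
      - (f y - P.eval (y : ℂ)) := by ring
    rw [htri]
    refine (norm_sub_le _ _).trans ?_
    have := norm_add_le (f x - P.eval (x : ℂ)) (P.eval (x : ℂ) - P.eval (y : ℂ))
    rw [hS, mul_add] at hεS
    linarith
  rw [accPt_iff_nhds] at hacc
  have hLpos : 0 < L := by positivity
  set d₀ := min (1 / 4) (1 / (16 * L ^ 2)) with hd₀
  have hd₀pos : 0 < d₀ := by positivity
  obtain ⟨x, ⟨hxb, hxW⟩, hxne⟩ := hacc _ (Metric.ball_mem_nhds x₀ hd₀pos)
  rw [Metric.mem_ball, Real.dist_eq] at hxb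
  set d := |x - x₀| with hd
  have hdpos : 0 < d := abs_pos.2 (sub_ne_zero.2 hxne)
  obtain ⟨y, ⟨hyb, hyW⟩, hyne⟩ := hacc _ (Metric.ball_mem_nhds x₀ (show 0 < d / 4 by positivity))
  rw [Metric.mem_ball, Real.dist_eq] at hyb
  have hd4 : d < 1 / 4 := hxb.trans_le (min_le_left _ _)
  have hd16 : 16 * L ^ 2 * d < 1 := by
    have := hxb.trans_le (min_le_right _ _)
    rw [lt_div_iff₀ (by positivity)] at this
    linarith
  have h1 := hLip x y hxW hyW hd4 (by linarith)
  have hfx : f x = (Real.sqrt d : ℂ) := by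
    simp only [f]
    rw [min_eq_left]
    rw [Real.sqrt_le_left zero_le_one]; linarith
  have hfy : f y = (Real.sqrt |y - x₀| : ℂ) := by
    simp only [f]
    rw [min_eq_left]
    rw [Real.sqrt_le_left zero_le_one]; linarith
  rw [hfx, hfy, ← Complex.ofReal_sub, Complex.norm_real, Real.norm_eq_abs] at h1
  have h2 : Real.sqrt |y - x₀| ≤ Real.sqrt d / 2 := by
    rw [Real.sqrt_le_left (by positivity), div_pow, Real.sq_sqrt hdpos.le]
    linarith
  have h3 : |x - y| ≤ 2 * d := by
    have := abs_sub_le x x₀ y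
    rw [abs_sub_comm x₀ y] at this
    linarith
  have h4 : Real.sqrt d / 2 ≤ L * (2 * d) := by
    have := le_abs_self (Real.sqrt d - Real.sqrt |y - x₀|)
    have : L * |x - y| ≤ L * (2 * d) := by gcongr
    linarith
  set s := Real.sqrt d
  have hs : 0 < s := Real.sqrt_pos.2 hdpos
  have hsd : s ^ 2 = d := Real.sq_sqrt hdpos.le
  rw [← hsd] at h4 hd16
  have h5 : 1 ≤ 4 * L * s := by
    by_contra hcon
    push Not at hcon
    nlinarith
  nlinarith

lemma jensen_le {R : ℝ} {f : ℂ → ℂ} (hR : 0 < R)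
    (hf : AnalyticOnNhd ℂ f (Metric.closedBall 0 |R|)) (h0 : f 0 ≠ 0) :
    Real.log ‖f 0‖ ≤ Real.circleAverage (fun z => Real.log ‖f z‖) 0 R := by
  rw [AnalyticOnNhd.circleAverage_log_norm hR.ne' hf h0]
  refine le_add_of_nonneg_left (finsum_nonneg fun u => ?_)
  by_cases hu : u ∈ Metric.closedBall (0 : ℂ) |R|
  · refine mul_nonneg ?_ ?_
    · have := MeromorphicOn.AnalyticOnNhd.divisor_nonneg hf u
      exact_mod_cast this
    · by_cases hu0 : u = 0
      · simp [hu0]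
      · apply Real.log_nonneg
        rw [Metric.mem_closedBall, dist_comm, dist_eq_norm, abs_of_pos hR] at hu
        have : 0 < ‖0 - u‖ := by simpa using hu0
        rw [← div_eq_mul_inv, one_le_div this]
        exact hu
  · rw [Function.locallyFinsuppWithin.apply_eq_zero_of_notMem _ hu]
    simp

lemma phi_im {w : ℂ} (hw : ‖w‖ < 1) : 0 < (I * (1 + w) / (1 - w)).im := by
  have h1 : 1 - w ≠ 0 := by
    intro h
    have : w = 1 := (sub_eq_zero.1 h).symm
    rw [this] at hw; simp at hw
  have h2 : 0 < Complex.normSq (1 - w) := Complex.normSq_pos.2 h1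
  have h3 : w.re ^ 2 + w.im ^ 2 < 1 := by
    have h4 : ‖w‖ ^ 2 < 1 := by
      have := norm_nonneg w
      nlinarith
    rw [← Complex.normSq_eq_norm_sq, Complex.normSq_apply] at h4
    nlinarith
  rw [Complex.div_im, ← sub_div]
  have : (I * (1 + w)).im * (1 - w).re / Complex.normSq (1 - w) -
    (I * (1 + w)).re * (1 - w).im / Complex.normSq (1 - w) =
    (1 - (w.re ^ 2 + w.im ^ 2)) / Complex.normSq (1 - w) := by
    rw [← sub_div]
    congr 1
    simp
    ring
  rw [sub_div, this]
  exact div_pos (by linarith) h2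

lemma G0 (F : ℂ → ℂ) (hF : DifferentiableOn ℂ F {z | -1 < z.im}) (C δ : ℝ) (hδ : 0 < δ)
    (hδC : δ ≤ C) (hb : ∀ z : ℂ, 0 ≤ z.im → ‖F z‖ ≤ C) (h0 : F I ≠ 0) :
    ∫⁻ t : ℝ, 2 * kk t * ENNReal.ofReal (Real.log C - Real.log (max ‖F t‖ δ)) ≤
      ENNReal.ofReal (2 * Real.pi * (Real.log C - Real.log ‖F I‖)) := by
  have hCpos : 0 < C := hδ.trans_le hδC
  have hopen : IsOpen {z : ℂ | -1 < z.im} := isOpen_lt continuous_const Complex.continuous_im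
  set φ : ℂ → ℂ := fun w => I * (1 + w) / (1 - w) with hφ
  set g : ℂ → ℂ := fun w => F (φ w) with hg
  have hne : ∀ w ∈ Metric.ball (0 : ℂ) 1, 1 - w ≠ 0 := by
    intro w hw h
    have : w = 1 := (sub_eq_zero.1 h).symm
    rw [this] at hw; simp at hw
  have hgd : DifferentiableOn ℂ g (Metric.ball 0 1) := by
    refine hF.comp (t := {z : ℂ | -1 < z.im}) ?_ ?_
    · intro w hw
      refine DifferentiableAt.differentiableWithinAt ?_
      exact DifferentiableAt.div (by fun_prop) (by fun_prop) (hne w hw)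
    · intro w hw
      have := phi_im (w := w) (by simpa using hw)
      simp only [mem_setOf_eq, φ]
      linarith
  have hg0 : g 0 = F I := by simp [hg, hφ]
  have hgC : ∀ w ∈ Metric.ball (0 : ℂ) 1, ‖g w‖ ≤ C := fun w hw =>
    hb _ (phi_im (w := w) (by simpa using hw)).le
  -- the averages at radius `r`
  have hr : ∀ r : ℝ, 0 < r → r < 1 →
      ∫⁻ t : ℝ, 2 * kk t * ENNReal.ofReal (Real.log C -
        Real.log (max ‖g (circleMap 0 r (2 * Real.arctan t + Real.pi))‖ δ)) ≤
      ENNReal.ofReal (2 * Real.pi * (Real.log C - Real.log ‖F I‖)) := by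
    intro r hr0 hr1
    have hsub : Metric.closedBall (0 : ℂ) |r| ⊆ Metric.ball 0 1 := by
      rw [abs_of_pos hr0]; exact Metric.closedBall_subset_ball hr1
    have han : AnalyticOnNhd ℂ (fun w => g w / δ) (Metric.closedBall 0 |r|) := by
      have : AnalyticOnNhd ℂ (fun w => g w / δ) (Metric.ball 0 1) :=
        (hgd.div_const (δ : ℂ)).analyticOnNhd Metric.isOpen_ball
      exact this.mono hsub
    have hδc : (δ : ℂ) ≠ 0 := by exact_mod_cast hδ.ne'
    have hj := jensen_le hr0 han (by rw [hg0]; exact div_ne_zero h0 hδc)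
    have hcont : ContinuousOn (fun w => Real.log (max ‖g w‖ δ)) (Metric.ball 0 1) := by
      refine ContinuousOn.log ?_ ?_
      · exact hgd.continuousOn.norm.sup continuousOn_const
      · intro w _
        exact (hδ.trans_le (le_max_right _ _)).ne'
    have hcontr := hcont.mono (Metric.sphere_subset_closedBall.trans hsub)
    rw [abs_of_pos hr0] at hcontr
    have hci : CircleIntegrable (fun w => Real.log (max ‖g w‖ δ)) 0 r :=
      hcontr.circleIntegrable hr0.le
    have hj2 : Real.log ‖g 0 / δ‖ ≤
        Real.circleAverage (fun w => Real.log (max ‖g w‖ δ) - Real.log δ) 0 r := by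
      refine hj.trans (Real.circleAverage_mono ?_ ?_ ?_)
      · exact (han.mono Metric.sphere_subset_closedBall).meromorphicOn.circleIntegrable_log_norm
      · exact hci.sub (circleIntegrable_const _ _ _)
      · intro w hw
        rcases (norm_nonneg (g w)).eq_or_lt with hgw | hgw
        · have : g w = 0 := by simpa using hgw.symm
          simp [this, hδ.le]
        · rw [norm_div, Complex.norm_real, Real.norm_eq_abs, abs_of_pos hδ,
            Real.log_div hgw.ne' hδ.ne']
          gcongr
          exact le_max_left _ _
    have hj3 : Real.log ‖F I‖ ≤ Real.circleAverage (fun w => Real.log (max ‖g w‖ δ)) 0 r := by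
      rw [Real.circleAverage_fun_sub hci (circleIntegrable_const _ _ _),
        Real.circleAverage_const, hg0, norm_div, Complex.norm_real, Real.norm_eq_abs,
        abs_of_pos hδ, Real.log_div (by simpa using h0) hδ.ne'] at hj2
      linarith
    have hj4 : Real.circleAverage (fun w => Real.log C - Real.log (max ‖g w‖ δ)) 0 r ≤
        Real.log C - Real.log ‖F I‖ := by
      rw [Real.circleAverage_fun_sub (circleIntegrable_const _ _ _) hci,
        Real.circleAverage_const]
      linarith
    have hci2 : CircleIntegrable (fun w => Real.log C - Real.log (max ‖g w‖ δ)) 0 r :=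
      (circleIntegrable_const _ _ _).sub hci
    rw [← circ_sub (fun θ => ENNReal.ofReal (Real.log C -
        Real.log (max ‖g (circleMap 0 r θ)‖ δ)))]
    have hpi := Real.pi_pos
    rw [Real.circleAverage_def, smul_eq_mul, inv_mul_le_iff₀ (by positivity),
      intervalIntegral.integral_of_le (by positivity), integral_Ioc_eq_integral_Ioo] at hj4
    have hii : IntegrableOn (fun θ => Real.log C - Real.log (max ‖g (circleMap 0 r θ)‖ δ))
        (Ioo 0 (2 * Real.pi)) := by
      have h5 : IntervalIntegrable (fun θ => Real.log C - Real.log (max ‖g (circleMap 0 r θ)‖ δ))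
        volume 0 (2 * Real.pi) := hci2
      rw [intervalIntegrable_iff_integrableOn_Ioo_of_le (by positivity)] at h5
      exact h5
    rw [← ofReal_integral_eq_lintegral_ofReal hii]
    · exact ENNReal.ofReal_le_ofReal hj4
    · refine Eventually.of_forall fun θ => ?_
      simp only [Pi.zero_apply, sub_nonneg]
      refine Real.log_le_log (hδ.trans_le (le_max_right _ _)) (max_le ?_ hδC)
      apply hgC
      simp [abs_of_pos hr0, hr1]
  -- Fatou
  set r : ℕ → ℝ := fun n => 1 - 1 / ((n : ℝ) + 2) with hrdef
  have hr0 : ∀ n, 0 < r n := by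
    intro n
    have : 1 / ((n : ℝ) + 2) < 1 := by
      rw [div_lt_one (by positivity)]; linarith [n.cast_nonneg (α := ℝ)]
    simp only [hrdef]; linarith
  have hr1 : ∀ n, r n < 1 := by
    intro n
    have : 0 < 1 / ((n : ℝ) + 2) := by positivity
    simp only [hrdef]; linarith
  have hrt : Tendsto r atTop (nhds 1) := by
    have h1 : Tendsto (fun n : ℕ => 1 / ((n : ℝ) + 2)) atTop (nhds 0) := by
      simp only [one_div]
      exact tendsto_inv_atTop_zero.comp
        (tendsto_atTop_add_const_right _ _ tendsto_natCast_atTop_atTop)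
    have h2 := h1.const_sub 1
    rw [sub_zero] at h2
    exact h2
  have hgcm : ∀ n, Continuous fun t : ℝ =>
      g (circleMap 0 (r n) (2 * Real.arctan t + Real.pi)) := by
    intro n
    refine hgd.continuousOn.comp_continuous ?_ ?_
    · exact (continuous_circleMap 0 (r n)).comp
        ((Real.continuous_arctan.const_mul 2).add continuous_const)
    · intro t
      simp [abs_of_pos (hr0 n), hr1 n]
  have hfatou := lintegral_liminf_le (μ := volume) (u := atTop) (f := fun (n : ℕ) (t : ℝ) =>
    2 * kk t * ENNReal.ofReal (Real.log C -
        Real.log (max ‖g (circleMap 0 (r n) (2 * Real.arctan t + Real.pi))‖ δ))) (by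
      intro n
      refine (measurable_kk.const_mul 2).mul (ENNReal.measurable_ofReal.comp ?_)
      refine measurable_const.sub (Real.measurable_log.comp ?_)
      exact ((hgcm n).norm.measurable).max measurable_const)
  refine le_trans (le_trans (lintegral_mono fun t => ?_) hfatou) ?_
  · apply le_of_eq
    symm
    apply Tendsto.liminf_eq
    refine ENNReal.Tendsto.const_mul ?_ (Or.inr ?_)
    · refine (ENNReal.continuous_ofReal.tendsto _).comp ?_
      refine Tendsto.const_sub _ ?_
      refine Tendsto.log ?_ (hδ.trans_le (le_max_right _ _)).ne'
      refine Tendsto.max ?_ tendsto_const_nhds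
      refine Tendsto.norm ?_
      have hx : (t : ℂ) + I ≠ 0 := by
        intro h; have := congrArg Complex.im h; simp at this
      have hcm : ∀ n, circleMap 0 (r n) (2 * Real.arctan t + Real.pi) =
          (r n : ℂ) * ((t - I) / (t + I)) := by
        intro n
        rw [← circ_pt]; simp [circleMap]
      simp only [hcm, hg]
      have hFt : ContinuousAt F t :=
        (hF.differentiableAt (hopen.mem_nhds (by simp))).continuousAt
      have hφt : Tendsto (fun n => φ ((r n : ℂ) * ((t - I) / (t + I)))) atTop (nhds (t : ℂ)) := by
        set w : ℂ := (t - I) / (t + I) with hw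
        have h1w : 1 - w = 2 * I / (t + I) := by rw [hw]; field_simp; ring
        have h1w0 : 1 - w ≠ 0 := by rw [h1w]; simp [hx]
        have hphi : φ w = t := by
          simp only [hφ]
          rw [div_eq_iff h1w0, h1w, hw]; field_simp; ring
        have hc : ContinuousAt φ w :=
          ContinuousAt.div (by fun_prop) (by fun_prop) h1w0
        have hlim : Tendsto (fun n => (r n : ℂ) * w) atTop (nhds w) := by
          have h1 : Tendsto (fun n => (r n : ℂ)) atTop (nhds ((1 : ℝ) : ℂ)) :=
            (Complex.continuous_ofReal.tendsto _).comp hrt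
          simpa using h1.mul_const w
        have := hc.tendsto.comp hlim
        rw [hphi] at this
        exact this
      exact hFt.tendsto.comp hφt
    · exact ENNReal.mul_ne_top (by simp) (by simp [kk])
  · refine liminf_le_of_frequently_le' (Frequently.of_forall fun n => ?_)
    exact hr (r n) (hr0 n) (hr1 n)

lemma G1 (F : ℂ → ℂ) (hF : DifferentiableOn ℂ F {z | -1 < z.im}) (C : ℝ)
    (hb : ∀ z : ℂ, 0 ≤ z.im → ‖F z‖ ≤ C) (h0 : F I ≠ 0) (m : ℝ → ℝ≥0∞)
    (hm : ∀ t : ℝ, m t ≤ ⨆ n : ℕ, ENNReal.ofReal (Real.log C -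
      Real.log (max ‖F t‖ (C / (n + 1))))) :
    ∫⁻ t, m t * kk t ≠ ⊤ := by
  have hCpos : 0 < C := (norm_pos_iff.2 h0).trans_le (hb I (by simp))
  have hcont : Continuous fun t : ℝ => F t :=
    hF.continuousOn.comp_continuous Complex.continuous_ofReal (fun t => by simp)
  have hle : ∫⁻ t, m t * kk t ≤ ∫⁻ t : ℝ, ⨆ n : ℕ, 2 * kk t * ENNReal.ofReal (Real.log C -
      Real.log (max ‖F t‖ (C / (n + 1)))) := by
    refine lintegral_mono fun t => ?_
    simp only [← ENNReal.mul_iSup]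
    calc m t * kk t ≤ kk t * ⨆ n : ℕ, ENNReal.ofReal (Real.log C -
          Real.log (max ‖F t‖ (C / (n + 1)))) := by
          rw [mul_comm]; gcongr; exact hm t
      _ ≤ _ := by
        gcongr
        exact le_mul_of_one_le_left zero_le (by norm_num)
  refine (hle.trans_lt ?_).ne
  rw [lintegral_iSup]
  · refine lt_of_le_of_lt (iSup_le fun n => G0 F hF C (C / (n + 1)) (by positivity) ?_ hb h0)
      ENNReal.ofReal_lt_top
    exact div_le_self hCpos.le (by linarith [n.cast_nonneg (α := ℝ)])
  · intro n
    refine (measurable_kk.const_mul 2).mul (ENNReal.measurable_ofReal.comp ?_)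
    exact measurable_const.sub (Real.measurable_log.comp (hcont.norm.measurable.max measurable_const))
  · intro n k hnk t
    simp only
    gcongr

abbrev AA : Type := lp (fun _ : ℝ => ℂ) ∞

noncomputable def mkA (f : ℝ → ℂ) (h : ∃ C : ℝ, ∀ x, ‖f x‖ ≤ C) : AA :=
  ⟨f, memℓp_infty ⟨h.choose, by rintro _ ⟨x, rfl⟩; exact h.choose_spec x⟩⟩

lemma mkA_apply (f : ℝ → ℂ) (h) (x : ℝ) : (mkA f h : ∀ _ : ℝ, ℂ) x = f x := rfl

lemma AA_ext {a b : AA} (h : ∀ x, a x = b x) : a = b := lp.ext (funext h)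

lemma AA_norm_le {a : AA} {C : ℝ} (hC : 0 ≤ C) (h : ∀ x, ‖a x‖ ≤ C) : ‖a‖ ≤ C :=
  lp.norm_le_of_forall_le hC h

lemma AA_mul (a b : AA) (x : ℝ) : (a * b : AA) x = a x * b x := by
  rw [lp.infty_coeFn_mul]; rfl

noncomputable def gfun (z : ℂ) (x : ℝ) : ℂ := if z.im = 0 then 0 else ((x : ℂ) - z)⁻¹

lemma gfun_bd (z : ℂ) (x : ℝ) : ‖gfun z x‖ ≤ |z.im|⁻¹ := by
  unfold gfun
  split_ifs with h
  · simp
  · rw [norm_inv]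
    apply inv_anti₀ (abs_pos.2 h)
    have := Complex.abs_im_le_norm ((x : ℂ) - z)
    simpa using this

noncomputable def gA (z : ℂ) : AA := mkA (gfun z) ⟨_, gfun_bd z⟩

lemma gA_apply {z : ℂ} (hz : z.im ≠ 0) (x : ℝ) : (gA z : ∀ _ : ℝ, ℂ) x = ((x : ℂ) - z)⁻¹ := by
  unfold gA
  rw [mkA_apply, gfun, if_neg hz]

lemma gA_norm (z : ℂ) : ‖gA z‖ ≤ |z.im|⁻¹ :=
  AA_norm_le (by positivity) (gfun_bd z)

lemma x_sub_ne {z : ℂ} (hz : z.im ≠ 0) (x : ℝ) : (x : ℂ) - z ≠ 0 := by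
  intro h
  have := congrArg Complex.im h
  simp at this
  exact hz this

lemma gA_resolvent {z z' : ℂ} (hz : z.im ≠ 0) (hz' : z'.im ≠ 0) :
    gA z' - gA z = (z' - z) • (gA z * gA z') := by
  refine AA_ext fun x => ?_
  rw [lp.coeFn_sub, Pi.sub_apply, lp.coeFn_smul, Pi.smul_apply, AA_mul, gA_apply hz, gA_apply hz',
    smul_eq_mul]
  have := x_sub_ne hz x
  have := x_sub_ne hz' x
  field_simp
  ring

lemma im_ne_eventually {z : ℂ} (hz : z.im ≠ 0) : ∀ᶠ z' in nhds z, z'.im ≠ 0 ∧ |z.im| / 2 < |z'.im| := by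
  have h1 : ContinuousAt (fun z' : ℂ => |z'.im|) z := by fun_prop
  have h2 : ∀ᶠ z' in nhds z, |z.im| / 2 < |z'.im| :=
    h1.eventually_const_lt (by have := abs_pos.2 hz; linarith)
  filter_upwards [h2] with z' h
  refine ⟨fun h0 => ?_, h⟩
  rw [h0, abs_zero] at h
  have := abs_pos.2 hz
  linarith

lemma gA_cont {z : ℂ} (hz : z.im ≠ 0) : ContinuousAt gA z := by
  rw [ContinuousAt, tendsto_iff_norm_sub_tendsto_zero]
  have h1 : Tendsto (fun z' : ℂ => ‖z' - z‖ * (|z.im|⁻¹ * (|z.im| / 2)⁻¹)) (nhds z) (nhds 0) := by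
    have : ContinuousAt (fun z' : ℂ => ‖z' - z‖ * (|z.im|⁻¹ * (|z.im| / 2)⁻¹)) z := by fun_prop
    simpa [ContinuousAt] using this
  refine squeeze_zero' (Eventually.of_forall fun _ => norm_nonneg _) ?_ h1
  filter_upwards [im_ne_eventually hz] with z' ⟨h, h'⟩
  rw [gA_resolvent hz h, norm_smul]
  have hp := abs_pos.2 hz
  gcongr
  refine (norm_mul_le _ _).trans ?_
  gcongr
  · exact gA_norm z
  · refine (gA_norm z').trans ?_
    exact inv_anti₀ (by positivity) h'.le

lemma gA_deriv {z : ℂ} (hz : z.im ≠ 0) : HasDerivAt gA (gA z * gA z) z := by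
  rw [hasDerivAt_iff_tendsto_slope]
  have h1 : Tendsto (fun z' => gA z * gA z') (nhdsWithin z {z}ᶜ) (nhds (gA z * gA z)) :=
    ((gA_cont hz).tendsto.const_mul _).mono_left nhdsWithin_le_nhds
  refine h1.congr' ?_
  filter_upwards [self_mem_nhdsWithin, nhdsWithin_le_nhds (im_ne_eventually hz)] with z' hne ⟨h, _⟩
  rw [slope_def_module, gA_resolvent hz h, smul_smul, inv_mul_cancel₀ (sub_ne_zero.2 hne), one_smul]

noncomputable def VS : Submodule ℂ AA := (Submodule.span ℂ ({1} ∪ gA '' {z | z.im ≠ 0})).topologicalClosure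

lemma VS_closed : IsClosed (VS : Set AA) := Submodule.isClosed_topologicalClosure _

lemma VS_sub {a : AA} (h : a ∈ ({1} ∪ gA '' {z | z.im ≠ 0} : Set AA)) : a ∈ VS :=
  Submodule.le_topologicalClosure _ (Submodule.subset_span h)

lemma VS_min {T : Submodule ℂ AA} (hT : IsClosed (T : Set AA)) (h1 : 1 ∈ T)
    (h : ∀ z : ℂ, z.im ≠ 0 → gA z ∈ T) : VS ≤ T := by
  refine Submodule.topologicalClosure_minimal _ (Submodule.span_le.2 ?_) hT
  rintro _ (rfl | ⟨z, hz, rfl⟩)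
  · exact h1
  · exact h z hz

lemma VS_gen_mul {z z' : ℂ} (hz : z.im ≠ 0) (hz' : z'.im ≠ 0) : gA z * gA z' ∈ VS := by
  have key : ∀ y : ℂ, y.im ≠ 0 → y ≠ z → gA z * gA y ∈ VS := by
    intro y hy hne
    have := gA_resolvent hz hy
    have h2 : gA z * gA y = (y - z)⁻¹ • (gA y - gA z) := by
      rw [this, smul_smul, inv_mul_cancel₀ (sub_ne_zero.2 hne), one_smul]
    rw [h2]
    exact VS.smul_mem _ (VS.sub_mem (VS_sub (Or.inr ⟨y, hy, rfl⟩)) (VS_sub (Or.inr ⟨z, hz, rfl⟩)))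
  by_cases hne : z' = z
  · subst hne
    have h1 : Tendsto (fun y => gA z' * gA y) (nhdsWithin z' {z'}ᶜ) (nhds (gA z' * gA z')) :=
      ((gA_cont hz).tendsto.const_mul _).mono_left nhdsWithin_le_nhds
    refine VS_closed.mem_of_tendsto h1 ?_
    filter_upwards [self_mem_nhdsWithin, nhdsWithin_le_nhds (im_ne_eventually hz)] with y hn ⟨h, _⟩
    exact key y h hn
  · exact key z' hz' hne

lemma VS_gA_mul {z : ℂ} (hz : z.im ≠ 0) {b : AA} (hb : b ∈ VS) : gA z * b ∈ VS := by
  have : VS ≤ VS.comap (LinearMap.mulLeft ℂ (gA z)) := by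
    refine VS_min ?_ ?_ ?_
    · exact VS_closed.preimage (continuous_const.mul continuous_id)
    · simp only [Submodule.mem_comap, LinearMap.mulLeft_apply, mul_one]
      exact VS_sub (Or.inr ⟨z, hz, rfl⟩)
    · intro y hy
      exact VS_gen_mul hz hy
  exact this hb

lemma VS_mul {a b : AA} (ha : a ∈ VS) (hb : b ∈ VS) : a * b ∈ VS := by
  have : VS ≤ VS.comap (LinearMap.mulRight ℂ b) := by
    refine VS_min ?_ ?_ ?_
    · exact VS_closed.preimage (continuous_id.mul continuous_const)
    · simpa using hb
    · intro y hy
      exact VS_gA_mul hy hb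
  exact this ha

noncomputable def resA (h : C(OnePoint ℝ, ℂ)) : AA := mkA (fun x => h (x : OnePoint ℝ)) ⟨‖h‖, fun _ => h.norm_coe_le_norm _⟩

lemma resA_cont : Continuous resA := by
  refine LipschitzWith.continuous (K := 1) (LipschitzWith.of_dist_le_mul fun a b => ?_)
  rw [dist_eq_norm, dist_eq_norm, NNReal.coe_one, one_mul]
  refine AA_norm_le (norm_nonneg _) fun x => ?_
  rw [lp.coeFn_sub, Pi.sub_apply]
  exact (a - b).norm_coe_le_norm (x : OnePoint ℝ)

noncomputable def gC : C(OnePoint ℝ, ℂ) :=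
  OnePoint.continuousMapMk ⟨fun x : ℝ => ((x : ℂ) - I)⁻¹, by
    refine Continuous.inv₀ (by fun_prop) (x_sub_ne (by simp))⟩ 0 (by
    rw [coclosedCompact_eq_cocompact]
    refine tendsto_inv₀_cobounded.comp ?_
    rw [← tendsto_norm_atTop_iff_cobounded]
    have h1 : Tendsto (fun x : ℝ => ‖x‖ - 1) (cocompact ℝ) atTop :=
      tendsto_atTop_add_const_right _ _ (tendsto_norm_cocompact_atTop)
    refine tendsto_atTop_mono (fun x => ?_) h1
    have := norm_sub_norm_le (x : ℂ) I
    simpa using this)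

lemma gC_coe (x : ℝ) : gC (x : OnePoint ℝ) = ((x : ℂ) - I)⁻¹ := rfl
lemma gC_infty : gC (OnePoint.infty) = 0 := rfl

lemma gC_inj : Function.Injective gC := by
  intro a b h
  induction a using OnePoint.rec with
  | infty =>
    induction b using OnePoint.rec with
    | infty => rfl
    | coe y =>
      rw [gC_infty, gC_coe] at h
      exact absurd h.symm (inv_ne_zero (x_sub_ne (by simp) y))
  | coe x =>
    induction b using OnePoint.rec with
    | infty =>
      rw [gC_infty, gC_coe] at h
      exact absurd h (inv_ne_zero (x_sub_ne (by simp) x))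
    | coe y =>
      rw [gC_coe, gC_coe] at h
      have h2 := inv_injective h
      have h3 : (x : ℂ) = y := by simpa using h2
      rw [Complex.ofReal_injective h3]

lemma resA_mem (h : C(OnePoint ℝ, ℂ)) : resA h ∈ VS := by
  have hd := ContinuousMap.starSubalgebra_topologicalClosure_eq_top_of_separatesPoints
    (𝕜 := ℂ) (StarAlgebra.adjoin ℂ {gC}) (by
      intro a b hab
      refine ⟨gC, ⟨gC, StarAlgebra.subset_adjoin ℂ _ rfl, rfl⟩, fun h => hab (gC_inj h)⟩)
  have hm : h ∈ (StarAlgebra.adjoin ℂ {gC}).topologicalClosure := by rw [hd]; trivial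
  have hm2 : h ∈ closure ((StarAlgebra.adjoin ℂ {gC} : StarSubalgebra ℂ C(OnePoint ℝ, ℂ)) : Set C(OnePoint ℝ, ℂ)) := hm
  have hsub : closure ((StarAlgebra.adjoin ℂ {gC} : StarSubalgebra ℂ C(OnePoint ℝ, ℂ)) : Set C(OnePoint ℝ, ℂ)) ⊆ resA ⁻¹' VS := by
    refine closure_minimal ?_ (VS_closed.preimage resA_cont)
    intro f hf
    suffices H : resA f ∈ VS ∧ resA (star f) ∈ VS from H.1
    have hf' : f ∈ StarAlgebra.adjoin ℂ ({gC} : Set C(OnePoint ℝ, ℂ)) := hf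
    induction hf' using StarAlgebra.adjoin_induction with
    | mem x hx =>
      rw [mem_singleton_iff] at hx
      subst hx
      constructor
      · have : resA gC = gA I := AA_ext fun x => by
          rw [gA_apply (by simp)]; rfl
        rw [this]
        exact VS_sub (Or.inr ⟨I, by simp, rfl⟩)
      · have : resA (star gC) = gA (-I) := AA_ext fun x => by
          rw [gA_apply (by simp)]
          change star (((x : ℂ) - I)⁻¹) = _
          simp
        rw [this]
        exact VS_sub (Or.inr ⟨-I, by simp, rfl⟩)
    | algebraMap r =>
      have : ∀ r : ℂ, resA (algebraMap ℂ _ r) ∈ VS := by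
        intro r
        have : resA (algebraMap ℂ _ r) = r • (1 : AA) := AA_ext fun x => by
          rw [lp.coeFn_smul, Pi.smul_apply, lp.infty_coeFn_one]
          change r = r • (1 : ℂ)
          simp
        rw [this]
        exact VS.smul_mem _ (VS_sub (Or.inl rfl))
      refine ⟨this r, ?_⟩
      have h2 := this (star r)
      rwa [algebraMap_star_comm] at h2
    | add x y hx hy h1 h2 =>
      have h1 := h1 hx
      have h2 := h2 hy
      have e : ∀ a b, resA (a + b) = resA a + resA b := fun a b => AA_ext fun _ => rfl
      rw [star_add, e, e]
      exact ⟨VS.add_mem h1.1 h2.1, VS.add_mem h1.2 h2.2⟩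
    | mul x y hx hy h1 h2 =>
      have h1 := h1 hx
      have h2 := h2 hy
      have e : ∀ a b, resA (a * b) = resA a * resA b := fun a b => AA_ext fun _ => by
        rw [AA_mul]; rfl
      rw [star_mul, e, e]
      exact ⟨VS_mul h1.1 h2.1, VS_mul h2.2 h1.2⟩
    | star x hx h1 =>
      have h1 := h1 hx
      rw [star_star]
      exact ⟨h1.2, h1.1⟩
  exact hsub hm2

noncomputable def wf (W : ℝ → ℝ≥0∞) (x : ℝ) : ℝ := ((W x)⁻¹).toReal

lemma wf_nonneg (W : ℝ → ℝ≥0∞) (x : ℝ) : 0 ≤ wf W x := ENNReal.toReal_nonneg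

lemma div_W {W : ℝ → ℝ≥0∞} (h1 : ∀ x, 1 ≤ W x) {a : ℝ} (ha : 0 ≤ a) (x : ℝ) :
    ENNReal.ofReal a / W x = ENNReal.ofReal (a * wf W x) := by
  have : (W x)⁻¹ ≠ ⊤ := by
    rw [Ne, ENNReal.inv_eq_top]
    exact (lt_of_lt_of_le one_pos (h1 x)).ne'
  rw [ENNReal.ofReal_mul ha, wf, ENNReal.ofReal_toReal this, div_eq_mul_inv]

lemma wf_le_one {W : ℝ → ℝ≥0∞} (h1 : ∀ x, 1 ≤ W x) (x : ℝ) : wf W x ≤ 1 := by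
  unfold wf
  have : (W x)⁻¹ ≤ 1 := ENNReal.inv_le_one.2 (h1 x)
  exact ENNReal.toReal_le_of_le_ofReal zero_le_one (by simpa using this)

lemma tail {W : ℝ → ℝ≥0∞} (h1 : ∀ x, 1 ≤ W x) {f : ℝ → ℂ}
    (hf : Tendsto (fun x : ℝ => ENNReal.ofReal (‖f x‖) / W x)
      (comap (fun x : ℝ => |x|) atTop) (nhds 0)) {ε : ℝ} (hε : 0 < ε) :
    ∃ R : ℝ, 0 < R ∧ ∀ x, R ≤ |x| → ‖f x‖ * wf W x ≤ ε := by
  have h2 : ∀ᶠ x in comap (fun x : ℝ => |x|) atTop,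
      ENNReal.ofReal (‖f x‖) / W x ≤ ENNReal.ofReal ε :=
    (hf.eventually_lt_const (ENNReal.ofReal_pos.2 hε)).mono fun x hx => hx.le
  rw [eventually_comap] at h2
  obtain ⟨R, hR⟩ := eventually_atTop.1 h2
  refine ⟨max R 1, by positivity, fun x hx => ?_⟩
  have := hR |x| ((le_max_left _ _).trans hx) x rfl
  rw [div_W h1 (norm_nonneg _)] at this
  exact (ENNReal.ofReal_le_ofReal_iff hε.le).1 this

lemma norm_mul_wf (W : ℝ → ℝ≥0∞) (a : ℂ) (x : ℝ) : ‖a * (wf W x : ℂ)‖ = ‖a‖ * wf W x := by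
  rw [norm_mul, Complex.norm_real, Real.norm_eq_abs, abs_of_nonneg (wf_nonneg W x)]

lemma bdd_of_mem {W : ℝ → ℝ≥0∞} (h1 : ∀ x, 1 ≤ W x) {f : ℝ → ℂ} (hf : MemCW W f) :
    ∃ C : ℝ, ∀ x, ‖f x * (wf W x : ℂ)‖ ≤ C := by
  obtain ⟨R, hR0, hR⟩ := tail h1 hf.2 one_pos
  obtain ⟨B, hB⟩ := (isCompact_Icc (a := -R) (b := R)).exists_bound_of_continuousOn
    hf.1.continuousOn
  refine ⟨max 1 B, fun x => ?_⟩
  rw [norm_mul_wf]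
  by_cases hx : R ≤ |x|
  · exact (hR x hx).trans (le_max_left _ _)
  · push Not at hx
    rw [abs_lt] at hx
    refine le_trans ?_ ((hB x ⟨hx.1.le, hx.2.le⟩).trans (le_max_right _ _))
    exact mul_le_of_le_one_right (norm_nonneg _) (wf_le_one h1 x)

lemma bdd_poly {W : ℝ → ℝ≥0∞} (hW : IsWeight W) (P : Polynomial ℂ) :
    ∃ C : ℝ, ∀ x : ℝ, ‖P.eval (x : ℂ) * (wf W x : ℂ)‖ ≤ C := by
  obtain ⟨-, h1, hn, -⟩ := hW
  induction P using Polynomial.induction_on' with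
  | add p q hp hq =>
    obtain ⟨C, hC⟩ := hp
    obtain ⟨D, hD⟩ := hq
    refine ⟨C + D, fun x => ?_⟩
    rw [Polynomial.eval_add, add_mul]
    exact (norm_add_le _ _).trans (add_le_add (hC x) (hD x))
  | monomial n a =>
    have : MemCW W (fun x : ℝ => (x : ℂ) ^ n) := by
      refine ⟨by fun_prop, ?_⟩
      refine (hn n).congr fun x => ?_
      rw [norm_pow, Complex.norm_real, Real.norm_eq_abs]
    obtain ⟨C, hC⟩ := bdd_of_mem h1 this
    refine ⟨‖a‖ * C, fun x => ?_⟩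
    rw [Polynomial.eval_monomial, mul_assoc, norm_mul]
    gcongr
    exact hC x

noncomputable def pL {W : ℝ → ℝ≥0∞} (hW : IsWeight W) : Polynomial ℂ →ₗ[ℂ] AA where
  toFun P := mkA (fun x => P.eval (x : ℂ) * (wf W x : ℂ)) (bdd_poly hW P)
  map_add' P Q := AA_ext fun x => by
    rw [lp.coeFn_add, Pi.add_apply, mkA_apply, mkA_apply, mkA_apply, Polynomial.eval_add, add_mul]
  map_smul' a P := AA_ext fun x => by
    rw [lp.coeFn_smul, Pi.smul_apply, mkA_apply, mkA_apply, Polynomial.eval_smul, RingHom.id_apply,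
      smul_mul_assoc]

lemma pL_apply {W : ℝ → ℝ≥0∞} (hW : IsWeight W) (P : Polynomial ℂ) (x : ℝ) :
    (pL hW P : ∀ _ : ℝ, ℂ) x = P.eval (x : ℂ) * (wf W x : ℂ) := rfl

lemma pL_one {W : ℝ → ℝ≥0∞} (hW : IsWeight W) (x : ℝ) :
    (pL hW 1 : ∀ _ : ℝ, ℂ) x = (wf W x : ℂ) := by
  rw [pL_apply]; simp

lemma pL_one_norm {W : ℝ → ℝ≥0∞} (hW : IsWeight W) : ‖pL hW 1‖ ≤ 1 := by
  refine AA_norm_le zero_le_one fun x => ?_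
  rw [pL_one, Complex.norm_real, Real.norm_eq_abs, abs_of_nonneg (wf_nonneg W x)]
  exact wf_le_one hW.2.1 x

lemma pL_XW {W : ℝ → ℝ≥0∞} (hW : IsWeight W) {P : Polynomial ℂ} (hP : P ∈ XW W) :
    ‖pL hW P‖ ≤ 1 := by
  refine AA_norm_le zero_le_one fun x => ?_
  rw [pL_apply, norm_mul_wf]
  have h1 : ENNReal.ofReal (‖P.eval (x : ℂ)‖ * wf W x) ≤ 1 := by
    rw [← div_W hW.2.1 (norm_nonneg _)]
    exact ENNReal.div_le_of_le_mul (by simpa using hP x)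
  exact ENNReal.ofReal_le_one.1 h1

lemma pL_gA {W : ℝ → ℝ≥0∞} (hW : IsWeight W) (P : Polynomial ℂ) {z : ℂ} (hz : z.im ≠ 0) :
    ∃ Q : Polynomial ℂ, gA z * pL hW P = pL hW Q + P.eval z • (gA z * pL hW 1) := by
  have h1 : (Polynomial.X - Polynomial.C z) ∣ P - Polynomial.C (P.eval z) := by
    rw [Polynomial.dvd_iff_isRoot]; simp
  obtain ⟨Q, hQ⟩ := h1
  refine ⟨Q, AA_ext fun x => ?_⟩
  rw [lp.coeFn_add, Pi.add_apply, lp.coeFn_smul, Pi.smul_apply, AA_mul, AA_mul, gA_apply hz,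
    pL_apply, pL_apply, pL_one, smul_eq_mul]
  have h2 := congrArg (Polynomial.eval (x : ℂ)) hQ
  simp only [Polynomial.eval_sub, Polynomial.eval_mul, Polynomial.eval_C, Polynomial.eval_X] at h2
  have h3 := x_sub_ne hz x
  have h4 : P.eval (x : ℂ) = P.eval z + (x - z) * Q.eval (x : ℂ) := by rw [← h2]; ring
  rw [h4]
  field_simp
  ring

noncomputable def chi (R x : ℝ) : ℝ := max 0 (min 1 (R + 1 - |x|))

lemma chi_cont (R : ℝ) : Continuous (chi R) := by unfold chi; fun_prop

lemma chi_one {R x : ℝ} (h : |x| ≤ R) : chi R x = 1 := by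
  unfold chi
  rw [min_eq_left (by linarith), max_eq_right zero_le_one]

lemma chi_zero {R x : ℝ} (h : R + 1 ≤ |x|) : chi R x = 0 := by
  unfold chi
  exact max_eq_left ((min_le_right _ _).trans (by linarith))

lemma chi_abs (R x : ℝ) : |1 - chi R x| ≤ 1 := by
  have h0 : 0 ≤ chi R x := le_max_left _ _
  have h1 : chi R x ≤ 1 := max_le zero_le_one (min_le_left _ _)
  rw [abs_le]; constructor <;> linarith

noncomputable def cutC (f : ℝ → ℂ) (hf : Continuous f) (R : ℝ) : C(OnePoint ℝ, ℂ) :=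
  OnePoint.continuousMapMk ⟨fun x : ℝ => f x * (chi R x : ℂ), by
    have := chi_cont R
    fun_prop⟩ 0 (by
    rw [coclosedCompact_eq_cocompact]
    refine tendsto_const_nhds.congr' ?_
    have h1 : ∀ᶠ x : ℝ in cocompact ℝ, R + 1 ≤ ‖x‖ :=
      (tendsto_norm_cocompact_atTop (E := ℝ)).eventually_ge_atTop (R + 1)
    filter_upwards [h1] with x hx
    change (0 : ℂ) = f x * (chi R x : ℂ)
    rw [chi_zero hx]; simp)

lemma cutC_apply (f : ℝ → ℂ) (hf : Continuous f) (R x : ℝ) :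
    (resA (cutC f hf R) : ∀ _ : ℝ, ℂ) x = f x * (chi R x : ℂ) := rfl

lemma exists_L {W : ℝ → ℝ≥0∞} (hW : IsWeight W) (hD : ¬ PolyDense W) :
    ∃ L : AA →L[ℂ] ℂ, (∀ P, L (pL hW P) = 0) ∧ ∃ z : ℂ, z.im ≠ 0 ∧ L (gA z * pL hW 1) ≠ 0 := by
  have h1 := hW.2.1
  unfold PolyDense at hD
  push Not at hD
  obtain ⟨f, hf, ε, hε, hP⟩ := hD
  set fA : AA := mkA (fun x => f x * (wf W x : ℂ)) (bdd_of_mem h1 hf) with hfA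
  set S : Submodule ℂ AA := (LinearMap.range (pL hW)).topologicalClosure with hS
  have hSc : IsClosed (S : Set AA) := Submodule.isClosed_topologicalClosure _
  have hnot : fA ∉ S := by
    intro hmem
    have hmem2 : fA ∈ closure ((LinearMap.range (pL hW) : Submodule ℂ AA) : Set AA) := hmem
    obtain ⟨_, ⟨P, rfl⟩, hlt⟩ := Metric.mem_closure_iff.1 hmem2 ε hε
    refine absurd (hP P) (not_le.2 ?_)
    rw [dist_eq_norm] at hlt
    refine lt_of_le_of_lt (iSup_le fun x => ?_) ((ENNReal.ofReal_lt_ofReal_iff hε).2 hlt)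
    rw [div_W h1 (norm_nonneg _)]
    apply ENNReal.ofReal_le_ofReal
    rw [← norm_mul_wf, sub_mul]
    exact lp.norm_apply_le_norm (by simp) (fA - pL hW P) x
  have : IsClosed (S : Set AA) := hSc
  have hq0 : S.mkQ fA ≠ 0 := by
    rw [Ne, Submodule.mkQ_apply, Submodule.Quotient.mk_eq_zero]; exact hnot
  have hq : ‖S.mkQ fA‖ ≠ 0 := norm_ne_zero_iff.2 hq0
  obtain ⟨g, -, hg⟩ := exists_dual_vector ℂ (S.mkQ fA) hq
  let L : AA →L[ℂ] ℂ := g.comp S.mkQL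
  have hLS : ∀ a ∈ S, L a = 0 := by
    intro a ha
    change g (S.mkQ a) = 0
    rw [Submodule.mkQ_apply, (Submodule.Quotient.mk_eq_zero S).2 ha, map_zero]
  have hLf : L fA ≠ 0 := by
    change g (S.mkQ fA) ≠ 0
    rw [hg]
    exact (RCLike.ofReal_ne_zero (K := ℂ)).2 hq
  have hLP : ∀ P, L (pL hW P) = 0 := fun P =>
    hLS _ (Submodule.le_topologicalClosure _ ⟨P, rfl⟩)
  refine ⟨L, hLP, ?_⟩
  by_contra hcon
  push Not at hcon
  apply hLf
  have hV : VS ≤ LinearMap.ker ((L : AA →ₗ[ℂ] ℂ).comp (LinearMap.mulRight ℂ (pL hW 1))) := by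
    refine VS_min ?_ ?_ ?_
    · have : IsClosed ((fun a : AA => L (a * pL hW 1)) ⁻¹' {0}) :=
        isClosed_singleton.preimage (L.continuous.comp (continuous_id.mul continuous_const))
      exact this
    · change L (1 * pL hW 1) = 0
      rw [one_mul]; exact hLP 1
    · intro z hz
      exact hcon z hz
  have hcut : ∀ R, L (resA (cutC f hf.1 R) * pL hW 1) = 0 := fun R => hV (resA_mem _)
  have hsmall : ∀ δ : ℝ, 0 < δ → ‖L fA‖ ≤ ‖L‖ * δ := by
    intro δ hδ
    obtain ⟨R, hR0, hR⟩ := tail h1 hf.2 hδ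
    have h2 : L fA = L (fA - resA (cutC f hf.1 R) * pL hW 1) := by
      rw [map_sub, hcut, sub_zero]
    rw [h2]
    refine (L.le_opNorm _).trans ?_
    gcongr
    refine AA_norm_le hδ.le fun x => ?_
    rw [lp.coeFn_sub, Pi.sub_apply, AA_mul, cutC_apply, pL_one, hfA, mkA_apply]
    have h3 : f x * (wf W x : ℂ) - f x * (chi R x : ℂ) * (wf W x : ℂ) =
        ((1 - chi R x : ℝ) : ℂ) * (f x * (wf W x : ℂ)) := by push_cast; ring
    rw [h3, norm_mul, norm_mul_wf, Complex.norm_real, Real.norm_eq_abs]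
    by_cases hx : R ≤ |x|
    · have := hR x hx
      have h5 : 0 ≤ ‖f x‖ * wf W x := mul_nonneg (norm_nonneg _) (wf_nonneg W x)
      calc _ ≤ 1 * (‖f x‖ * wf W x) := by gcongr; exact chi_abs R x
        _ ≤ δ := by linarith
    · rw [chi_one (not_le.1 hx).le]; simp [hδ.le]
  rw [← norm_le_zero_iff]
  refine le_of_forall_pos_le_add fun η hη => ?_
  have hn : 0 < ‖L‖ + 1 := by positivity
  refine (hsmall (η / (‖L‖ + 1)) (by positivity)).trans ?_
  rw [zero_add, mul_div_assoc', div_le_iff₀ hn]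
  nlinarith

lemma measurable_elog : Measurable elog := by
  unfold elog
  refine Measurable.ite (measurableSet_singleton _) measurable_const ?_
  exact ENNReal.measurable_ofReal.comp (Real.measurable_log.comp ENNReal.measurable_toReal)

lemma measurable_MW (W : ℝ → ℝ≥0∞) : Measurable (MW W) := by
  refine LowerSemicontinuous.measurable ?_
  unfold MW
  refine lowerSemicontinuous_biSup fun P _ => Continuous.lowerSemicontinuous ?_
  exact ENNReal.continuous_ofReal.comp P.continuous.norm

lemma three_one {W : ℝ → ℝ≥0∞} (hW : IsWeight W) (hD : ¬ PolyDense W) :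
    (∫⁻ x : ℝ, elog (MW W x) / ENNReal.ofReal (1 + x ^ 2)) ≠ ⊤ := by
  obtain ⟨L, hLP, z₀, hz₀, hG⟩ := exists_L hW hD
  set a := z₀.re with ha
  set c := z₀.im / 2 with hc
  have hc0 : c ≠ 0 := div_ne_zero hz₀ two_ne_zero
  have hcpos : 0 < |c| := abs_pos.2 hc0
  set φ : ℂ → ℂ := fun ζ => a + c * (I + ζ) with hφ
  set F : ℂ → ℂ := fun ζ => L (gA (φ ζ) * pL hW 1) with hFdef
  have hφim : ∀ ζ, (φ ζ).im = c * (1 + ζ.im) := by intro ζ; simp [hφ]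
  have hφne : ∀ ζ : ℂ, -1 < ζ.im → (φ ζ).im ≠ 0 := by
    intro ζ h
    rw [hφim]
    exact mul_ne_zero hc0 (by linarith)
  have hgn : ∀ ζ : ℂ, 0 ≤ ζ.im → ‖gA (φ ζ)‖ ≤ |c|⁻¹ := by
    intro ζ h
    refine (gA_norm _).trans (inv_anti₀ hcpos ?_)
    rw [hφim, abs_mul, abs_of_nonneg (show 0 ≤ 1 + ζ.im by linarith)]
    nlinarith
  have hLb : ∀ ζ : ℂ, 0 ≤ ζ.im → ∀ u : AA, ‖u‖ ≤ 1 → ‖L (gA (φ ζ) * u)‖ ≤ ‖L‖ * |c|⁻¹ := by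
    intro ζ h u hu
    refine (L.le_opNorm _).trans ?_
    gcongr
    calc ‖gA (φ ζ) * u‖ ≤ ‖gA (φ ζ)‖ * ‖u‖ := norm_mul_le _ _
      _ ≤ |c|⁻¹ * 1 := by gcongr; exact hgn ζ h
      _ = _ := mul_one _
  set C := ‖L‖ * |c|⁻¹ with hC
  have hb : ∀ ζ : ℂ, 0 ≤ ζ.im → ‖F ζ‖ ≤ C := fun ζ h => hLb ζ h _ (pL_one_norm hW)
  have hFd : DifferentiableOn ℂ F {z | -1 < z.im} := by
    intro ζ hζ
    refine DifferentiableAt.differentiableWithinAt ?_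
    have h1 : DifferentiableAt ℂ gA (φ ζ) := (gA_deriv (hφne ζ hζ)).differentiableAt
    have h2 : DifferentiableAt ℂ φ ζ := by simp only [hφ]; fun_prop
    have h3 : DifferentiableAt ℂ (fun ζ => gA (φ ζ)) ζ := h1.comp ζ h2
    exact L.differentiableAt.comp ζ (h3.mul_const (pL hW 1))
  have hFI : F I ≠ 0 := by
    have : φ I = z₀ := by
      simp only [hφ, ha, hc]
      conv_rhs => rw [← Complex.re_add_im z₀]
      push_cast
      ring
    simp only [hFdef, this]
    exact hG
  have hCpos : 0 < C := (norm_pos_iff.2 hFI).trans_le (hb I (by simp))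
  set h : ℝ → ℝ≥0∞ := fun s => elog (MW W (s + c * I)) with hh
  have hhm : Measurable h := by
    refine measurable_elog.comp ((measurable_MW W).comp ?_)
    have : Continuous fun s : ℝ => (s + c * I : ℂ) := by fun_prop
    exact this.measurable
  have hG1 := G1 F hFd C hb hFI (fun t => h (a + c * t)) (by
    intro t
    refine elog_MW_le fun P hP => ?_
    have hz : (((a + c * t : ℝ) : ℂ) + c * I) = φ t := by simp only [hφ]; push_cast; ring
    rw [hz]
    unfold LP
    rcases (norm_nonneg (P.eval (φ t))).eq_or_lt with h0 | h0
    · rw [← h0]; simp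
    obtain ⟨n, hn⟩ := exists_nat_ge ‖P.eval (φ t)‖
    refine le_iSup_of_le n (ENNReal.ofReal_le_ofReal ?_)
    have hPF : ‖P.eval (φ t)‖ * ‖F t‖ ≤ C := by
      obtain ⟨Q, hQ⟩ := pL_gA hW P (hφne t (by simp))
      have h2 := hLb t (by simp) _ (pL_XW hW hP)
      rw [hQ, map_add, hLP, zero_add, map_smul, norm_smul] at h2
      exact h2
    have hmax : ‖P.eval (φ t)‖ * max ‖F t‖ (C / (n + 1)) ≤ C := by
      rw [mul_max_of_nonneg _ _ h0.le]
      refine max_le hPF ?_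
      rw [mul_div_assoc', div_le_iff₀ (by positivity)]
      nlinarith
    have hmpos : 0 < max ‖F t‖ (C / (n + 1)) := lt_max_of_lt_right (by positivity)
    have h3 := Real.log_le_log (mul_pos h0 hmpos) hmax
    rw [Real.log_mul h0.ne' hmpos.ne'] at h3
    linarith)
  have hK1 := K1 (fun t => h (a + c * t)) (-a / c) c⁻¹ (inv_ne_zero hc0)
  have hhint : ∫⁻ s, h s * kk s ≠ ⊤ := by
    have h2 : ENNReal.ofReal |c⁻¹| * ∫⁻ s, h s * kk s ≠ ⊤ := by
      refine ne_top_of_le_ne_top (ENNReal.mul_ne_top (a := ENNReal.ofReal (1 + 2 * (-a / c) ^ 2 + 2 * c⁻¹ ^ 2)) ENNReal.ofReal_ne_top hG1) ?_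
      refine le_trans (le_of_eq ?_) hK1
      congr 1
      refine lintegral_congr fun t => ?_
      congr 2
      field_simp
      ring
    intro htop
    rw [htop, ENNReal.mul_top] at h2
    · exact h2 rfl
    · simpa using hc0
  obtain ⟨D, hDt, hK2⟩ := K2 (-c) (neg_ne_zero.2 hc0)
  refine ne_top_of_le_ne_top (ENNReal.mul_ne_top hDt hhint) (le_trans ?_ (hK2 h hhm))
  refine lintegral_mono fun x => ?_
  simp only
  rw [div_eq_mul_inv, ← ENNReal.ofReal_inv_of_pos (by positivity)]
  change elog (MW W x) * kk x ≤ _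
  gcongr
  refine elog_MW_le fun P hP => ?_
  have h5 := poly_aff P (x + c * I) (-c)
  rw [show ((x : ℂ) + c * I + -c * I) = x by ring] at h5
  refine h5.trans (lintegral_mono fun t => ?_)
  simp only
  gcongr
  refine (LP_le_elog hP _).trans (le_of_eq ?_)
  simp only [hh]
  congr 2
  push_cast
  ring

theorem stmt13 (W : ℝ → ℝ≥0∞) (hW : IsWeight W) :
    List.TFAE [PolyDense W,
      (⨆ P ∈ XW W, ENNReal.ofReal
        (∫ x : ℝ, logPlus (‖P.eval (x : ℂ)‖) / (1 + x ^ 2))) = ⊤,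
      (∫⁻ x : ℝ, elog (MW W x) / ENNReal.ofReal (1 + x ^ 2)) = ⊤] := by
  tfae_have 1 → 2 := one_two W hW
  tfae_have 2 → 3 := by
    intro h
    have := two_three W
    rw [h] at this
    exact top_le_iff.1 this
  tfae_have 3 → 1 := by
    intro h
    by_contra hD
    exact three_one hW hD h
  tfae_finish
end
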